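/- arXiv:1501.03445 — 8 statements merged into one kernel-verified Lean document; each statement's English description precedes it below -/
import Mathlib

section
/- Fix q ∈ (0,1). For every real x > 0 define Γ_q(x) = (1−q)^{1−x} · (q;q)_∞ / (q^x;q)_∞. Then the function x ↦ log Γ_q(x) is differentiable on (0,∞), and for every x > 0 its derivative equals −log(1−q) + log(q) · ∑_{k=0}^{∞} q^{k+x}/(1 − q^{k+x}). -/
theorem qaux_log_tprod (q : ℝ) (h0 : 0 < q) (h1 : q < 1) (a : ℝ) (ha0 : 0 < a) (ha1 : a < 1) :
    (∀ i : ℕ, 0 < 1 - a * q ^ i) ∧ Summable (fun i : ℕ => Real.log (1 - a * q ^ i)) ∧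
    0 < ∏' i : ℕ, (1 - a * q ^ i) ∧
    Real.log (∏' i : ℕ, (1 - a * q ^ i)) = ∑' i : ℕ, Real.log (1 - a * q ^ i) := by
  have hpos : ∀ i : ℕ, 0 < 1 - a * q ^ i := by
    intro i
    have : q ^ i ≤ 1 := pow_le_one₀ h0.le h1.le
    have : 0 < q ^ i := pow_pos h0 i
    nlinarith
  have hs : Summable (fun i : ℕ => Real.log (1 - a * q ^ i)) := by
    have := Real.summable_log_one_add_of_summable
      (((summable_geometric_of_lt_one h0.le h1).mul_left a).neg)
    simpa [sub_eq_add_neg] using this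
  have he := Real.rexp_tsum_eq_tprod hpos hs
  refine ⟨hpos, hs, ?_, ?_⟩
  · rw [← he]; exact Real.exp_pos _
  · rw [← he, Real.log_exp]

theorem qaux_deriv (q : ℝ) (h0 : 0 < q) (h1 : q < 1) (x : ℝ) (hx : 0 < x) :
    HasDerivAt (fun y : ℝ => ∑' i : ℕ, Real.log (1 - q ^ y * q ^ i))
      (∑' i : ℕ, (-(Real.log q * 1 * q ^ x * q ^ i)) / (1 - q ^ x * q ^ i)) x := by
  have hc1 : q ^ (x / 2) < 1 := Real.rpow_lt_one h0.le h1 (by linarith)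
  have hlt : ∀ y : ℝ, 0 < y → q ^ y < 1 := fun y hy => Real.rpow_lt_one h0.le h1 hy
  refine hasDerivAt_tsum_of_isPreconnected (t := Set.Ioi (x / 2)) (y₀ := x)
    (u := fun n : ℕ => |Real.log q| / (1 - q ^ (x / 2)) * q ^ n)
    (g := fun (i : ℕ) (y : ℝ) => Real.log (1 - q ^ y * q ^ i))
    (g' := fun (i : ℕ) (y : ℝ) => (-(Real.log q * 1 * q ^ y * q ^ i)) / (1 - q ^ y * q ^ i))
    ((summable_geometric_of_lt_one h0.le h1).mul_left _) isOpen_Ioi isPreconnected_Ioi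
    ?_ ?_ (by simp [hx]) ?_ (by simp [hx])
  · intro n y hy
    have hy0 : 0 < y := by have := Set.mem_Ioi.1 hy; linarith
    have hp := (qaux_log_tprod q h0 h1 (q ^ y) (Real.rpow_pos_of_pos h0 y) (hlt y hy0)).1 n
    exact ((((hasDerivAt_id y).const_rpow h0).mul_const (q ^ n)).const_sub 1).log hp.ne'
  · intro n y hy
    have hy2 := Set.mem_Ioi.1 hy
    have hy0 : 0 < y := by linarith
    have hyp := Real.rpow_pos_of_pos h0 y
    have hp := (qaux_log_tprod q h0 h1 (q ^ y) hyp (hlt y hy0)).1 n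
    have hle : q ^ y ≤ q ^ (x / 2) := Real.rpow_le_rpow_of_exponent_ge h0 h1.le hy2.le
    have hn : q ^ n ≤ 1 := pow_le_one₀ h0.le h1.le
    have hn0 : 0 < q ^ n := pow_pos h0 n
    have hy1 := hlt y hy0
    rw [norm_div, norm_neg, mul_one, norm_mul, norm_mul, Real.norm_of_nonneg hp.le,
      Real.norm_of_nonneg hyp.le, Real.norm_of_nonneg hn0.le, Real.norm_eq_abs, div_mul_eq_mul_div]
    apply div_le_div₀
    · positivity
    · have := abs_nonneg (Real.log q)
      apply mul_le_mul_of_nonneg_right _ hn0.le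
      nlinarith
    · linarith
    · nlinarith
  · exact (qaux_log_tprod q h0 h1 (q ^ x) (Real.rpow_pos_of_pos h0 x) (hlt x hx)).2.1

/-- Fix `q ∈ (0,1)`. For `x > 0` define
`Γ_q(x) = (1−q)^{1−x} · (q;q)_∞ / (q^x;q)_∞`. Then `x ↦ log Γ_q x` is differentiable on
`(0,∞)` and its derivative at every `x > 0` equals
`−log(1−q) + log q · ∑_{k=0}^∞ q^{k+x}/(1 − q^{k+x})`. -/
theorem qGamma_log_deriv (q : ℝ) (hq : q ∈ Set.Ioo (0 : ℝ) 1) :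
    ∀ x ∈ Set.Ioi (0 : ℝ),
      DifferentiableAt ℝ
        (fun y : ℝ => Real.log
          ((1 - q) ^ (1 - y) * (∏' i : ℕ, (1 - q * q ^ i)) / ∏' i : ℕ, (1 - q ^ y * q ^ i))) x ∧
      deriv
        (fun y : ℝ => Real.log
          ((1 - q) ^ (1 - y) * (∏' i : ℕ, (1 - q * q ^ i)) / ∏' i : ℕ, (1 - q ^ y * q ^ i))) x
        = -Real.log (1 - q)
          + Real.log q * ∑' k : ℕ, q ^ ((k : ℝ) + x) / (1 - q ^ ((k : ℝ) + x)) := by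
  obtain ⟨h0, h1⟩ := hq
  intro x hx
  have hx : 0 < x := hx
  have key : HasDerivAt (fun y : ℝ => Real.log
          ((1 - q) ^ (1 - y) * (∏' i : ℕ, (1 - q * q ^ i)) / ∏' i : ℕ, (1 - q ^ y * q ^ i)))
      (-Real.log (1 - q)
          + Real.log q * ∑' k : ℕ, q ^ ((k : ℝ) + x) / (1 - q ^ ((k : ℝ) + x))) x := by
    have hd := ((((hasDerivAt_id x).const_sub 1).mul_const (Real.log (1 - q))).add_const
      (Real.log (∏' i : ℕ, (1 - q * q ^ i)))).sub (qaux_deriv q h0 h1 x hx)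
    have hval : -1 * Real.log (1 - q) -
        (∑' i : ℕ, (-(Real.log q * 1 * q ^ x * q ^ i)) / (1 - q ^ x * q ^ i)) =
        -Real.log (1 - q)
          + Real.log q * ∑' k : ℕ, q ^ ((k : ℝ) + x) / (1 - q ^ ((k : ℝ) + x)) := by
      rw [← tsum_mul_left, sub_eq_add_neg, ← tsum_neg, neg_one_mul]
      congr 1
      apply tsum_congr
      intro k
      rw [Real.rpow_add h0, Real.rpow_natCast, mul_comm (q ^ k) (q ^ x)]
      ring
    rw [hval] at hd
    refine hd.congr_of_eventuallyEq ?_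
    filter_upwards [Ioi_mem_nhds hx] with y hy
    have hy : 0 < y := hy
    obtain ⟨-, -, hP, -⟩ := qaux_log_tprod q h0 h1 q h0 h1
    obtain ⟨-, -, hQ, hL⟩ := qaux_log_tprod q h0 h1 (q ^ y) (Real.rpow_pos_of_pos h0 y)
      (Real.rpow_lt_one h0.le h1 hy)
    have h1q : 0 < 1 - q := by linarith
    have hr := Real.rpow_pos_of_pos h1q (1 - y)
    rw [Real.log_div (mul_pos hr hP).ne' hQ.ne', Real.log_mul hr.ne' hP.ne',
      Real.log_rpow h1q, hL]
    simp
  exact ⟨key.differentiableAt, key.deriv⟩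
end

section
/- Fix q ∈ (0,1) and define Ψ_q : (0,∞) → ℝ by Ψ_q(x) = −log(1−q) + log(q) · ∑_{k=0}^{∞} q^{k+x}/(1 − q^{k+x}). Then for every integer k ≥ 1 and every x > 0, the k-th iterated derivative of Ψ_q at x exists and equals (log q)^{k+1} · ∑_{n=1}^{∞} n^k q^{n x}/(1 − q^n). -/
/-- The real `q`-digamma function `Ψ_q`, defined by its series representation
(`q^y` below denotes the real power `exp(y log q)`). -/
noncomputable def qDigammaR (q : ℝ) (x : ℝ) : ℝ :=
  -Real.log (1 - q) + Real.log q * ∑' k : ℕ, q ^ ((k : ℝ) + x) / (1 - q ^ ((k : ℝ) + x))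

noncomputable def qdS (q : ℝ) (k : ℕ) (x : ℝ) : ℝ :=
  ∑' n : ℕ, ((n : ℝ) + 1) ^ k * q ^ (((n : ℝ) + 1) * x) / (1 - q ^ (n + 1))

lemma qd_rpow (q : ℝ) (h0 : 0 < q) (x : ℝ) (n : ℕ) :
    q ^ (((n : ℝ) + 1) * x) = (q ^ x) ^ (n + 1) := by
  rw [← Real.rpow_natCast (q ^ x), ← Real.rpow_mul h0.le]
  push_cast
  ring_nf

lemma qd_sum0 (q : ℝ) (h0 : 0 < q) (h1 : q < 1) (x : ℝ) (hx : 0 < x) :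
    ∑' k : ℕ, q ^ ((k : ℝ) + x) / (1 - q ^ ((k : ℝ) + x)) = qdS q 0 x := by
  set y := q ^ x with hy
  have hy0 : 0 < y := Real.rpow_pos_of_pos h0 x
  have hy1 : y < 1 := Real.rpow_lt_one h0.le h1 hx
  have hk : ∀ k : ℕ, q ^ ((k : ℝ) + x) = q ^ k * y := fun k => by
    rw [Real.rpow_add h0, Real.rpow_natCast]
  have hgeo : ∀ z : ℝ, 0 ≤ z → z < 1 → HasSum (fun n : ℕ => z ^ n) (1 - z)⁻¹ :=
    fun z a b => hasSum_geometric_of_lt_one a b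
  have e1 : ∀ k : ℕ, q ^ ((k : ℝ) + x) / (1 - q ^ ((k : ℝ) + x))
      = ∑' n : ℕ, (q ^ k * y) ^ (n + 1) := by
    intro k
    rw [hk]
    have hz0 : 0 ≤ q ^ k * y := by positivity
    have hz1 : q ^ k * y < 1 := by
      have := pow_le_one₀ (n := k) h0.le h1.le
      nlinarith
    have := ((hgeo _ hz0 hz1).mul_left (q ^ k * y)).tsum_eq
    simp only [pow_succ' (q ^ k * y)]
    rw [this, div_eq_mul_inv]
  have hs : Summable (Function.uncurry (fun (k n : ℕ) => (q ^ k * y) ^ (n + 1))) := by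
    have hb : Summable (fun p : ℕ × ℕ => q ^ p.1 * y ^ p.2) :=
      (hgeo q h0.le h1).summable.mul_of_nonneg (hgeo y hy0.le hy1).summable
        (fun k => by positivity) (fun k => by positivity)
    refine Summable.of_nonneg_of_le ?_ ?_ hb
    · rintro ⟨k, n⟩
      simp only [Function.uncurry]
      positivity
    · rintro ⟨k, n⟩
      simp only [Function.uncurry]
      rw [mul_pow, ← pow_mul]
      have a1 : q ^ (k * (n + 1)) ≤ q ^ k :=
        pow_le_pow_of_le_one h0.le h1.le (Nat.le_mul_of_pos_right k (Nat.succ_pos n))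
      have a2 : y ^ (n + 1) ≤ y ^ n := pow_le_pow_of_le_one hy0.le hy1.le (Nat.le_succ n)
      exact mul_le_mul a1 a2 (by positivity) (by positivity)
  rw [tsum_congr e1, ← hs.tsum_comm]
  unfold qdS
  refine tsum_congr fun n => ?_
  rw [qd_rpow q h0 x n, ← hy, pow_zero, one_mul]
  have hz1 : q ^ (n + 1) < 1 := pow_lt_one₀ h0.le h1 (Nat.succ_ne_zero n)
  have := ((hgeo (q ^ (n + 1)) (by positivity) hz1).mul_left (y ^ (n + 1))).tsum_eq
  rw [div_eq_mul_inv, ← this]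
  refine tsum_congr fun k => ?_
  rw [mul_pow, ← pow_mul, ← pow_mul, mul_comm k, mul_comm]

lemma qd_summable (q : ℝ) (h0 : 0 < q) (h1 : q < 1) (k : ℕ) (x : ℝ) (hx : 0 < x) :
    Summable (fun n : ℕ => ((n : ℝ) + 1) ^ k * q ^ (((n : ℝ) + 1) * x) / (1 - q ^ (n + 1))) := by
  have hy0 : 0 < q ^ x := Real.rpow_pos_of_pos h0 x
  have hy1 : q ^ x < 1 := Real.rpow_lt_one h0.le h1 hx
  have hs : Summable (fun n : ℕ => (n : ℝ) ^ k * (q ^ x) ^ n) :=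
    summable_pow_mul_geometric_of_norm_lt_one k (by rwa [Real.norm_of_nonneg hy0.le])
  have hs' := ((summable_nat_add_iff 1).2 hs).div_const (1 - q)
  refine Summable.of_nonneg_of_le ?_ ?_ hs'
  · intro n
    have hz1 : q ^ (n + 1) < 1 := pow_lt_one₀ h0.le h1 (Nat.succ_ne_zero n)
    have : 0 < 1 - q ^ (n + 1) := by linarith
    positivity
  · intro n
    have hz1 : q ^ (n + 1) ≤ q := pow_le_of_le_one h0.le h1.le (Nat.succ_ne_zero n)
    rw [qd_rpow q h0]
    push_cast
    have : 0 < 1 - q := by linarith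
    gcongr

lemma qd_deriv (q : ℝ) (h0 : 0 < q) (h1 : q < 1) (k : ℕ) (x : ℝ) (hx : 0 < x) :
    HasDerivAt (qdS q k) (Real.log q * qdS q (k + 1) x) x := by
  have hu := (qd_summable q h0 h1 (k + 1) (x / 2) (by linarith)).mul_left |Real.log q|
  have key := hasDerivAt_tsum_of_isPreconnected (𝕜 := ℝ)
    (g := fun (n : ℕ) (z : ℝ) => ((n : ℝ) + 1) ^ k * q ^ (((n : ℝ) + 1) * z) / (1 - q ^ (n + 1)))
    (g' := fun (n : ℕ) (z : ℝ) => Real.log q *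
      (((n : ℝ) + 1) ^ (k + 1) * q ^ (((n : ℝ) + 1) * z) / (1 - q ^ (n + 1))))
    (t := Set.Ioi (x / 2)) (y₀ := x) (y := x) hu isOpen_Ioi isPreconnected_Ioi ?_ ?_ ?_
    (qd_summable q h0 h1 k x hx) ?_
  · rw [tsum_mul_left] at key
    exact key
  · intro n z _
    have hd : HasDerivAt (fun z : ℝ => ((n : ℝ) + 1) * z) ((n : ℝ) + 1) z := by
      simpa using (hasDerivAt_id z).const_mul ((n : ℝ) + 1)
    have := ((hd.const_rpow h0).const_mul (((n : ℝ) + 1) ^ k)).div_const (1 - q ^ (n + 1))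
    refine this.congr_deriv ?_
    ring
  · intro n z hz
    have hz' : x / 2 < z := hz
    have hz1 : q ^ (n + 1) < 1 := pow_lt_one₀ h0.le h1 (Nat.succ_ne_zero n)
    have h2 : 0 < 1 - q ^ (n + 1) := by linarith
    rw [norm_mul, Real.norm_eq_abs, Real.norm_of_nonneg (by positivity)]
    have h3 : q ^ (((n : ℝ) + 1) * z) ≤ q ^ (((n : ℝ) + 1) * (x / 2)) :=
      Real.rpow_le_rpow_of_exponent_ge h0 h1.le (by gcongr)
    gcongr
  · exact (by linarith : x / 2 < x)
  · exact (by linarith : x / 2 < x)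

lemma qd_iter (q : ℝ) (h0 : 0 < q) (h1 : q < 1) (k : ℕ) :
    ∃ c : ℝ, (1 ≤ k → c = 0) ∧ ∀ x : ℝ, 0 < x →
      iteratedDeriv k (qDigammaR q) x = c + Real.log q ^ (k + 1) * qdS q k x := by
  induction k with
  | zero =>
    refine ⟨-Real.log (1 - q), by simp, fun x hx => ?_⟩
    rw [iteratedDeriv_zero, qDigammaR, qd_sum0 q h0 h1 x hx]
    ring
  | succ k ih =>
    obtain ⟨c, -, hc⟩ := ih
    refine ⟨0, fun _ => rfl, fun x hx => ?_⟩
    rw [iteratedDeriv_succ]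
    have he : iteratedDeriv k (qDigammaR q) =ᶠ[nhds x]
        fun x => c + Real.log q ^ (k + 1) * qdS q k x := by
      filter_upwards [Ioi_mem_nhds hx] with z hz using hc z hz
    rw [he.deriv_eq, (((qd_deriv q h0 h1 k x hx).const_mul _).const_add c).deriv]
    ring

/-- For `q ∈ (0,1)`, every integer `k ≥ 1` and every `x > 0`, the `k`-th
iterated derivative of `Ψ_q` at `x` exists and equals
`(log q)^{k+1} · ∑_{n=1}^∞ n^k q^{n x}/(1 − q^n)`. -/
theorem qdigamma_iteratedDeriv (q : ℝ) (hq : q ∈ Set.Ioo (0 : ℝ) 1) :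
    ∀ k : ℕ, 1 ≤ k → ∀ x : ℝ, 0 < x →
      DifferentiableAt ℝ (iteratedDeriv (k - 1) (qDigammaR q)) x ∧
      iteratedDeriv k (qDigammaR q) x
        = Real.log q ^ (k + 1) *
            ∑' n : ℕ, ((n : ℝ) + 1) ^ k * q ^ (((n : ℝ) + 1) * x) / (1 - q ^ (n + 1)) := by
  intro k hk x hx
  obtain ⟨h0, h1⟩ := hq
  constructor
  · obtain ⟨c, -, hc⟩ := qd_iter q h0 h1 (k - 1)
    have he : iteratedDeriv (k - 1) (qDigammaR q) =ᶠ[nhds x]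
        fun x => c + Real.log q ^ (k - 1 + 1) * qdS q (k - 1) x := by
      filter_upwards [Ioi_mem_nhds hx] with z hz using hc z hz
    exact ((((qd_deriv q h0 h1 (k - 1) x hx).const_mul _).const_add c).differentiableAt).congr_of_eventuallyEq he
  · obtain ⟨c, h, hc⟩ := qd_iter q h0 h1 k
    rw [hc x hx, h hk, zero_add, qdS]
end

section
/- Fix q ∈ (0,1), ν ∈ (0,1) and an integer k ≥ 2, and let u : ℤ^k → ℝ. Suppose that for every n⃗ ∈ ℤ^k and every index 1 ≤ i ≤ k−1 with n_i = n_{i+1}, (ν(1−q)/(1−qν))·u(n⃗⁻_{i,i+1}) + ((q−ν)/(1−qν))·u(n⃗⁻_{i+1}) + ((1−q)/(1−qν))·u(n⃗) − u(n⃗⁻_i) = 0. Then for every n⃗ ∈ ℤ^k and every index 1 ≤ i ≤ k−1 with n_i = n_{i+1}, (ν^{−1}(1−q^{−1})/(1−q^{−1}ν^{−1}))·u(n⃗⁺_{i,i+1}) + ((q^{−1}−ν^{−1})/(1−q^{−1}ν^{−1}))·u(n⃗⁺_i) + ((1−q^{−1})/(1−q^{−1}ν^{−1}))·u(n⃗)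 − u(n⃗⁺_{i+1}) = 0. -/
/-- `n⃗` with the `i`-th coordinate decreased by 1. -/
def decOne {k : ℕ} (n : Fin k → ℤ) (i : Fin k) : Fin k → ℤ :=
  Function.update n i (n i - 1)

/-- `n⃗` with the `i`-th coordinate increased by 1. -/
def incOne {k : ℕ} (n : Fin k → ℤ) (i : Fin k) : Fin k → ℤ :=
  Function.update n i (n i + 1)

/-- `n⃗` with the coordinates `i` and `i'` each decreased by 1. -/
def decTwo {k : ℕ} (n : Fin k → ℤ) (i i' : Fin k) : Fin k → ℤ :=
  fun t => if t = i ∨ t = i' then n t - 1 else n t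

/-- `n⃗` with the coordinates `i` and `i'` each increased by 1. -/
def incTwo {k : ℕ} (n : Fin k → ℤ) (i i' : Fin k) : Fin k → ℤ :=
  fun t => if t = i ∨ t = i' then n t + 1 else n t

/-- the two-body boundary condition with parameters `(q,ν)` implies the one
with inverted parameters `(q⁻¹,ν⁻¹)`. -/
theorem boundary_condition_inversion (q ν : ℝ) (hq : q ∈ Set.Ioo (0 : ℝ) 1)
    (hν : ν ∈ Set.Ioo (0 : ℝ) 1) (k : ℕ) (hk : 2 ≤ k) (u : (Fin k → ℤ) → ℝ)
    (hbc : ∀ (n : Fin k → ℤ) (i i' : Fin k), (i : ℕ) + 1 = (i' : ℕ) → n i = n i' →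
      (ν * (1 - q) / (1 - q * ν)) * u (decTwo n i i')
        + ((q - ν) / (1 - q * ν)) * u (decOne n i')
        + ((1 - q) / (1 - q * ν)) * u n
        - u (decOne n i) = 0) :
    ∀ (n : Fin k → ℤ) (i i' : Fin k), (i : ℕ) + 1 = (i' : ℕ) → n i = n i' →
      (ν⁻¹ * (1 - q⁻¹) / (1 - q⁻¹ * ν⁻¹)) * u (incTwo n i i')
        + ((q⁻¹ - ν⁻¹) / (1 - q⁻¹ * ν⁻¹)) * u (incOne n i)
        + ((1 - q⁻¹) / (1 - q⁻¹ * ν⁻¹)) * u n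
        - u (incOne n i') = 0 := by
  intro n i i' hi hn
  obtain ⟨hq0, hq1⟩ := hq
  obtain ⟨hν0, hν1⟩ := hν
  have hne : i ≠ i' := by
    rintro rfl
    omega
  have h := hbc (incTwo n i i') i i' hi (by simp [incTwo, hn])
  have h1 : decTwo (incTwo n i i') i i' = n := by
    funext t
    by_cases ht : t = i ∨ t = i' <;> simp [decTwo, incTwo, ht]
  have h2 : decOne (incTwo n i i') i' = incOne n i := by
    funext t
    simp only [decOne, incTwo, incOne, Function.update_apply]
    grind
  have h3 : decOne (incTwo n i i') i = incOne n i' := by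
    funext t
    simp only [decOne, incTwo, incOne, Function.update_apply]
    grind
  rw [h1, h2, h3] at h
  have hd : 1 - q * ν ≠ 0 := by nlinarith
  have hq' : q ≠ 0 := hq0.ne'
  have hν' : ν ≠ 0 := hν0.ne'
  have e0 : 1 - q⁻¹ * ν⁻¹ = -(1 - q * ν) / (q * ν) := by
    field_simp
    ring
  have e1 : ν⁻¹ * (1 - q⁻¹) / (1 - q⁻¹ * ν⁻¹) = (1 - q) / (1 - q * ν) := by
    rw [e0]
    field_simp
    ring
  have e2 : (q⁻¹ - ν⁻¹) / (1 - q⁻¹ * ν⁻¹) = (q - ν) / (1 - q * ν) := by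
    rw [e0]
    field_simp
    ring
  have e3 : (1 - q⁻¹) / (1 - q⁻¹ * ν⁻¹) = ν * (1 - q) / (1 - q * ν) := by
    rw [e0]
    field_simp
    ring
  rw [e1, e2, e3]
  linarith
end

section
/- Fix q ∈ (0,1), ν ∈ (0,1), and R, L ≥ 0 with R + L = 1, and set V = log ν / log q (so V > 0). Then for every θ > 0, ((1−q)/log q) · [ (R/ν)·Ψ_q'''(θ+V) − L·Ψ_q'''(θ) − ( (R/ν)·Ψ_q''(θ+V) − L·Ψ_q''(θ) ) · ( Ψ_q''(θ) − Ψ_q''(θ+V) ) / ( Ψ_q'(θ) − Ψ_q'(θ+V) ) ] > 0. (This is the statement f_0'''(θ) > 0 for the function f_0 arising in the saddle-point analysis; note Ψ_q'(θ) ≠ Ψ_q'(θ+V) since Ψ_q' is strictly decreasing on (0,∞).) -/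
/-- The `k`-th derivative of the `q`-digamma function, given by its series:
`Ψ_q^{(k)}(x) = (log q)^{k+1} ∑_{n=1}^∞ n^k q^{nx}/(1 − q^n)` (here `q^{nx}` is a real
power and `q^n` a natural power). -/
noncomputable def PsiD (q : ℝ) (k : ℕ) (x : ℝ) : ℝ :=
  Real.log q ^ (k + 1) * ∑' n : ℕ, ((n : ℝ) + 1) ^ k * q ^ (((n : ℝ) + 1) * x) / (1 - q ^ (n + 1))

lemma hs_congr {f g : ℕ → ℝ} {a : ℝ} (h : HasSum g a) (e : ∀ n, f n = g n) : HasSum f a := by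
  rwa [funext e]

lemma cheb_aux (w g : ℕ → ℝ) (c : ℝ) (hw : ∀ n, 0 < w n) (hg : StrictMono g)
    (s1 : Summable w) (s2 : Summable fun n : ℕ => ((n : ℝ) + 1) * w n)
    (s3 : Summable fun n => g n * w n) (s4 : Summable fun n : ℕ => ((n : ℝ) + 1) * (g n * w n))
    (hc : ∑' n : ℕ, ((n : ℝ) + 1) * w n = c * ∑' n, w n) :
    c * ∑' n, g n * w n < ∑' n : ℕ, ((n : ℝ) + 1) * (g n * w n) := by
  set N := ⌊c - 1⌋₊ with hN
  have h1 := (s4.hasSum.sub (s3.hasSum.mul_left c)).sub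
    ((s2.hasSum.sub (s1.hasSum.mul_left c)).mul_left (g N))
  rw [hc] at h1
  have hgt : ∀ n : ℕ, N < n → c < (n : ℝ) + 1 := by
    intro n hn
    have := (Nat.floor_lt' (by omega : n ≠ 0)).1 hn
    linarith
  have hpos : ∀ n : ℕ, N < n → 0 < ((n : ℝ) + 1) * (g n * w n) - c * (g n * w n)
      - g N * (((n : ℝ) + 1) * w n - c * w n) := by
    intro n hn
    have e1 := hgt n hn
    have e2 := hg hn
    have : 0 < ((n : ℝ) + 1 - c) * (g n - g N) * w n :=
      mul_pos (mul_pos (by linarith) (by linarith)) (hw n)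
    linarith
  have hnn : ∀ n : ℕ, 0 ≤ ((n : ℝ) + 1) * (g n * w n) - c * (g n * w n)
      - g N * (((n : ℝ) + 1) * w n - c * w n) := by
    intro n
    rcases lt_trichotomy N n with h | h | h
    · exact (hpos n h).le
    · subst h; apply le_of_eq; ring
    · have e2 := hg h
      have e3 : (n : ℝ) + 1 ≤ c := by
        have h0 : 1 ≤ N := by omega
        have := (Nat.le_floor_iff' (by omega : N ≠ 0)).1 hN.le
        have h3 : (n : ℝ) ≤ N := by exact_mod_cast h.le
        linarith
      have : 0 ≤ (c - ((n : ℝ) + 1)) * (g N - g n) * w n :=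
        mul_nonneg (mul_nonneg (by linarith) (by linarith)) (hw n).le
      linarith
  have h2 := h1.summable.tsum_pos hnn (N + 1) (hpos _ (Nat.lt_succ_self N))
  rw [h1.tsum_eq] at h2
  linarith

lemma g1_mono (v : ℝ) (h0 : 0 < v) (h1 : v < 1) :
    StrictMono fun n : ℕ => ((n : ℝ) + 1) / (1 - v ^ (n + 1)) := by
  have hp : ∀ n : ℕ, 0 < 1 - v ^ (n + 1) := fun n =>
    sub_pos.2 (pow_lt_one₀ h0.le h1 (by omega))
  apply strictMono_nat_of_lt_succ
  intro n
  have F : ∀ k : ℕ, 0 < 1 - ((k : ℝ) + 2) * v ^ (k + 1) + ((k : ℝ) + 1) * v ^ (k + 2) := by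
    intro k
    induction k with
    | zero => norm_num; nlinarith [sq_pos_of_pos (sub_pos.2 h1)]
    | succ k ih =>
      have : 0 < ((k : ℝ) + 2) * v ^ (k + 1) * (1 - v) ^ 2 :=
        mul_pos (by positivity) (sq_pos_of_pos (sub_pos.2 h1))
      push_cast
      ring_nf at *
      linarith
  rw [div_lt_div_iff₀ (hp n) (hp (n + 1))]
  have := F n
  push_cast
  ring_nf at *
  linarith

lemma g2_mono (v : ℝ) (h0 : 0 < v) (h1 : v < 1) :
    StrictMono fun n : ℕ => -(((n : ℝ) + 1) * v ^ (n + 1) / (1 - v ^ (n + 1))) := by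
  have hp : ∀ n : ℕ, 0 < 1 - v ^ (n + 1) := fun n =>
    sub_pos.2 (pow_lt_one₀ h0.le h1 (by omega))
  apply strictMono_nat_of_lt_succ
  intro n
  have G : ∀ k : ℕ, 0 < ((k : ℝ) + 1) - ((k : ℝ) + 2) * v + v ^ (k + 2) := by
    intro k
    induction k with
    | zero => norm_num; nlinarith [sq_pos_of_pos (sub_pos.2 h1)]
    | succ k ih =>
      have : 0 < (1 - v ^ (k + 1 + 1)) * (1 - v) := mul_pos (hp _) (sub_pos.2 h1)
      push_cast
      ring_nf at *
      linarith
  rw [neg_lt_neg_iff, div_lt_div_iff₀ (hp (n + 1)) (hp n)]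
  have := mul_pos (pow_pos h0 (n + 1)) (G n)
  push_cast
  ring_nf at *
  linarith

lemma summ_aux (q r : ℝ) (hq0 : 0 < q) (hq1 : q < 1) (hr0 : 0 < r) (hr1 : r < 1) (k : ℕ) :
    Summable fun n : ℕ => ((n : ℝ) + 1) ^ k * r ^ (n + 1) / (1 - q ^ (n + 1)) := by
  have h := summable_pow_mul_geometric_of_norm_lt_one (R := ℝ) k (r := r)
    (by rw [Real.norm_eq_abs, abs_of_pos hr0]; exact hr1)
  have h' := ((summable_nat_add_iff 1).2 h).div_const (1 - q)
  have hb : ∀ n : ℕ, 1 - q ≤ 1 - q ^ (n + 1) := fun n => by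
    have := pow_le_of_le_one hq0.le hq1.le (by omega : n + 1 ≠ 0)
    linarith
  refine Summable.of_nonneg_of_le (fun n => ?_) (fun n => ?_) h'
  · have := hb n
    exact div_nonneg (by positivity) (by linarith)
  · push_cast
    exact div_le_div_of_nonneg_left (by positivity) (by linarith) (hb n)

/-- positivity of `f₀'''(θ)`.  For `q, ν ∈ (0,1)`, `R, L ≥ 0` with `R+L = 1`
and `V = log ν / log q`, for every `θ > 0`,
`((1−q)/log q)·[(R/ν)Ψ_q'''(θ+V) − LΨ_q'''(θ)
  − ((R/ν)Ψ_q''(θ+V) − LΨ_q''(θ))·(Ψ_q''(θ) − Ψ_q''(θ+V))/(Ψ_q'(θ) − Ψ_q'(θ+V))] > 0`. -/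
theorem f0_third_derivative_positive (q ν R L : ℝ) (hq : q ∈ Set.Ioo (0 : ℝ) 1)
    (hν : ν ∈ Set.Ioo (0 : ℝ) 1) (hR : 0 ≤ R) (hL : 0 ≤ L) (hRL : R + L = 1)
    (V : ℝ) (hV : V = Real.log ν / Real.log q) :
    ∀ θ : ℝ, 0 < θ →
      0 < ((1 - q) / Real.log q) *
        ((R / ν) * PsiD q 3 (θ + V) - L * PsiD q 3 θ
          - ((R / ν) * PsiD q 2 (θ + V) - L * PsiD q 2 θ) *
            (PsiD q 2 θ - PsiD q 2 (θ + V)) / (PsiD q 1 θ - PsiD q 1 (θ + V))) := by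
  intro θ hθ
  obtain ⟨hq0, hq1⟩ := hq
  obtain ⟨hv0, hv1⟩ := hν
  have hl : Real.log q < 0 := Real.log_neg hq0 hq1
  set r := q ^ θ with hr
  have hr0 : 0 < r := Real.rpow_pos_of_pos hq0 _
  have hr1 : r < 1 := Real.rpow_lt_one hq0.le hq1 hθ
  have hqV : q ^ V = ν := by
    rw [Real.rpow_def_of_pos hq0, hV, mul_div_cancel₀ _ hl.ne, Real.exp_log hv0]
  have hpow : ∀ x : ℝ, ∀ n : ℕ, q ^ (((n : ℝ) + 1) * x) = (q ^ x) ^ (n + 1) := by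
    intro x n
    rw [mul_comm, Real.rpow_mul hq0.le, ← Real.rpow_natCast]
    push_cast; rfl
  have hrV : q ^ (θ + V) = r * ν := by rw [Real.rpow_add hq0, hqV]
  have hs0 : 0 < r * ν := mul_pos hr0 hv0
  have hs1 : r * ν < 1 := by nlinarith
  have A := summ_aux q r hq0 hq1 hr0 hr1
  have B := summ_aux q (r * ν) hq0 hq1 hs0 hs1
  have hpq : ∀ n : ℕ, 0 < 1 - q ^ (n + 1) := fun n =>
    sub_pos.2 (pow_lt_one₀ hq0.le hq1 (by omega))
  have hpv : ∀ n : ℕ, 0 < 1 - ν ^ (n + 1) := fun n =>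
    sub_pos.2 (pow_lt_one₀ hv0.le hv1 (by omega))
  unfold PsiD
  simp only [hpow, hrV, ← hr]
  set S : ℕ → ℝ := fun k => ∑' n : ℕ, ((n : ℝ) + 1) ^ k * r ^ (n + 1) / (1 - q ^ (n + 1)) with hS
  set T : ℕ → ℝ := fun k => ∑' n : ℕ, ((n : ℝ) + 1) ^ k * (r * ν) ^ (n + 1) / (1 - q ^ (n + 1))
    with hT
  have eS : ∀ k, ∑' n : ℕ, ((n : ℝ) + 1) ^ k * r ^ (n + 1) / (1 - q ^ (n + 1)) = S k :=
    fun _ => rfl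
  have eT : ∀ k, ∑' n : ℕ, ((n : ℝ) + 1) ^ k * (r * ν) ^ (n + 1) / (1 - q ^ (n + 1)) = T k :=
    fun _ => rfl
  simp only [eS, eT]
  have hSs : ∀ k, HasSum (fun n : ℕ => ((n : ℝ) + 1) ^ k * r ^ (n + 1) / (1 - q ^ (n + 1))) (S k) :=
    fun k => (A k).hasSum
  have hTs : ∀ k, HasSum
      (fun n : ℕ => ((n : ℝ) + 1) ^ k * (r * ν) ^ (n + 1) / (1 - q ^ (n + 1))) (T k) :=
    fun k => (B k).hasSum
  set w : ℕ → ℝ := fun n : ℕ => ((n : ℝ) + 1) * r ^ (n + 1) * (1 - ν ^ (n + 1)) / (1 - q ^ (n + 1))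
    with hw
  have hwpos : ∀ n, 0 < w n := fun n =>
    div_pos (mul_pos (by positivity) (hpv n)) (hpq n)
  have w1 : HasSum w (S 1 - T 1) := by
    refine hs_congr ((hSs 1).sub (hTs 1)) (fun n => ?_)
    simp only [hw, mul_pow]; ring
  have w2 : HasSum (fun n : ℕ => ((n : ℝ) + 1) * w n) (S 2 - T 2) := by
    refine hs_congr ((hSs 2).sub (hTs 2)) (fun n => ?_)
    simp only [hw, mul_pow]; ring
  have D1 : 0 < S 1 - T 1 := by
    rw [← w1.tsum_eq]; exact w1.summable.tsum_pos (fun n => (hwpos n).le) 0 (hwpos 0)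
  have cc : ∑' n : ℕ, ((n : ℝ) + 1) * w n = ((S 2 - T 2) / (S 1 - T 1)) * ∑' n, w n := by
    rw [w1.tsum_eq, w2.tsum_eq, div_mul_cancel₀ _ D1.ne']
  set c := (S 2 - T 2) / (S 1 - T 1) with hc
  have g1 : HasSum (fun n : ℕ => ((n : ℝ) + 1) / (1 - ν ^ (n + 1)) * w n) (S 2) := by
    refine hs_congr (hSs 2) (fun n => ?_)
    have := (hpv n).ne'
    have := (hpq n).ne'
    simp only [hw]; field_simp
  have g1' : HasSum (fun n : ℕ => ((n : ℝ) + 1) * (((n : ℝ) + 1) / (1 - ν ^ (n + 1)) * w n))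
      (S 3) := by
    refine hs_congr (hSs 3) (fun n => ?_)
    have := (hpv n).ne'
    have := (hpq n).ne'
    simp only [hw]; field_simp
  have g2 : HasSum (fun n : ℕ => -(((n : ℝ) + 1) * ν ^ (n + 1) / (1 - ν ^ (n + 1))) * w n)
      (-T 2) := by
    refine hs_congr ((hTs 2).neg) (fun n => ?_)
    have := (hpv n).ne'
    have := (hpq n).ne'
    simp only [hw, mul_pow]; field_simp
  have g2' : HasSum (fun n : ℕ => ((n : ℝ) + 1) *
      (-(((n : ℝ) + 1) * ν ^ (n + 1) / (1 - ν ^ (n + 1))) * w n)) (-T 3) := by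
    refine hs_congr ((hTs 3).neg) (fun n => ?_)
    have := (hpv n).ne'
    have := (hpq n).ne'
    simp only [hw, mul_pow]; field_simp
  have K1 := cheb_aux w _ c hwpos (g1_mono ν hv0 hv1) w1.summable w2.summable g1.summable
    g1'.summable cc
  have K2 := cheb_aux w _ c hwpos (g2_mono ν hv0 hv1) w1.summable w2.summable g2.summable
    g2'.summable cc
  rw [g1.tsum_eq, g1'.tsum_eq] at K1
  rw [g2.tsum_eq, g2'.tsum_eq] at K2
  have key : (1 - q) / Real.log q * (R / ν * (Real.log q ^ (3 + 1) * T 3)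
      - L * (Real.log q ^ (3 + 1) * S 3) - (R / ν * (Real.log q ^ (2 + 1) * T 2)
      - L * (Real.log q ^ (2 + 1) * S 2)) * (Real.log q ^ (2 + 1) * S 2
      - Real.log q ^ (2 + 1) * T 2) / (Real.log q ^ (1 + 1) * S 1 - Real.log q ^ (1 + 1) * T 1))
      = (1 - q) * (-Real.log q) ^ 3 * (R / ν * (c * T 2 - T 3) + L * (S 3 - c * S 2)) := by
    have hl' := hl.ne
    have hD := D1.ne'
    rw [hc, ← mul_sub, ← mul_sub]
    generalize S 1 - T 1 = d at *
    field_simp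
    ring
  rw [key]
  refine mul_pos (mul_pos (by linarith) (pow_pos (by linarith) 3)) ?_
  have x1 : 0 < c * T 2 - T 3 := by linarith
  have x2 : 0 < S 3 - c * S 2 := by linarith
  rcases hR.eq_or_lt with h | h
  · have : L = 1 := by linarith
    rw [← h, this]; simpa using x2
  · exact add_pos_of_pos_of_nonneg (mul_pos (div_pos h hv0) x1) (mul_nonneg hL x2.le)
end

section
/- Fix q ∈ (0,1). The function x ↦ Ψ_q'''(x)/Ψ_q''(x) is strictly increasing on (0,∞). (Note Ψ_q''(x) < 0 for all x > 0, so the quotient is well defined.) -/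
namespace PsiAux

noncomputable def f (q : ℝ) (k : ℕ) (x : ℝ) (n : ℕ) : ℝ :=
  ((n : ℝ) + 1) ^ k * q ^ (((n : ℝ) + 1) * x) / (1 - q ^ (n + 1))

lemma den_pos {q : ℝ} (h0 : 0 < q) (h1 : q < 1) (n : ℕ) : 0 < 1 - q ^ (n + 1) :=
  sub_pos.2 (pow_lt_one₀ h0.le h1 (by omega))

lemma f_pos {q : ℝ} (h0 : 0 < q) (h1 : q < 1) (k : ℕ) (x : ℝ) (n : ℕ) : 0 < f q k x n := by
  have := den_pos h0 h1 n
  have := Real.rpow_pos_of_pos h0 (((n : ℝ) + 1) * x)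
  unfold f
  positivity

lemma f_summable {q : ℝ} (h0 : 0 < q) (h1 : q < 1) (k : ℕ) {x : ℝ} (hx : 0 < x) :
    Summable (f q k x) := by
  have hr0 : 0 < q ^ x := Real.rpow_pos_of_pos h0 x
  have hr1 : q ^ x < 1 := Real.rpow_lt_one h0.le h1 hx
  have hs : Summable (fun n : ℕ => (n : ℝ) ^ k * (q ^ x) ^ n) :=
    summable_pow_mul_geometric_of_norm_lt_one k (by rwa [Real.norm_of_nonneg hr0.le])
  have hs2 := ((summable_nat_add_iff 1).2 hs).mul_right (1 - q)⁻¹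
  refine Summable.of_nonneg_of_le (fun n => (f_pos h0 h1 k x n).le) (fun n => ?_) hs2
  have hd := den_pos h0 h1 n
  have e : q ^ (((n : ℝ) + 1) * x) = (q ^ x) ^ (n + 1) := by
    rw [← Real.rpow_natCast, ← Real.rpow_mul h0.le]
    push_cast
    ring_nf
  unfold f
  rw [e, div_eq_mul_inv]
  push_cast
  have hq1 : 0 < 1 - q := sub_pos.2 h1
  have : q ^ (n + 1) ≤ q := pow_le_of_le_one h0.le h1.le (by omega)
  gcongr

lemma f_three (q : ℝ) (x : ℝ) (n : ℕ) : f q 3 x n = ((n : ℝ) + 1) * f q 2 x n := by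
  unfold f
  ring

lemma term_strict {q : ℝ} (h0 : 0 < q) (h1 : q < 1) {x y : ℝ} (hxy : x < y) (M : ℝ) (n : ℕ)
    (hn : (n : ℝ) + 1 ≠ M) :
    0 < ((n : ℝ) + 1 - M) * f q 2 x n - q ^ (M * (x - y)) * (((n : ℝ) + 1 - M) * f q 2 y n) := by
  have hf := f_pos h0 h1 2 y n
  have e : f q 2 x n = q ^ (((n : ℝ) + 1) * (x - y)) * f q 2 y n := by
    have : q ^ (((n : ℝ) + 1) * x) = q ^ (((n : ℝ) + 1) * (x - y)) * q ^ (((n : ℝ) + 1) * y) := by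
      rw [← Real.rpow_add h0]
      ring_nf
    unfold f
    rw [this]
    ring
  rw [e]
  have key : 0 < ((n : ℝ) + 1 - M) * (q ^ (((n : ℝ) + 1) * (x - y)) - q ^ (M * (x - y))) := by
    rcases lt_or_gt_of_ne hn with h | h
    · refine mul_pos_of_neg_of_neg (by linarith) (sub_neg.2 ?_)
      exact Real.rpow_lt_rpow_of_exponent_gt h0 h1 (by nlinarith)
    · refine mul_pos (by linarith) (sub_pos.2 ?_)
      exact Real.rpow_lt_rpow_of_exponent_gt h0 h1 (by nlinarith)
  have := mul_pos key hf
  linarith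

lemma main {q : ℝ} (h0 : 0 < q) (h1 : q < 1) {x y : ℝ} (hx : 0 < x) (hxy : x < y) :
    (∑' n, f q 3 y n) / (∑' n, f q 2 y n) < (∑' n, f q 3 x n) / (∑' n, f q 2 x n) := by
  have hy := hx.trans hxy
  have sx2 := f_summable h0 h1 2 hx
  have sx3 := f_summable h0 h1 3 hx
  have sy2 := f_summable h0 h1 2 hy
  have sy3 := f_summable h0 h1 3 hy
  have px := sx2.tsum_pos (fun n => (f_pos h0 h1 2 x n).le) 0 (f_pos h0 h1 2 x 0)
  have py := sy2.tsum_pos (fun n => (f_pos h0 h1 2 y n).le) 0 (f_pos h0 h1 2 y 0)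
  set M := (∑' n, f q 3 y n) / (∑' n, f q 2 y n) with hM
  have hMy : (∑' n, f q 3 y n) - M * (∑' n, f q 2 y n) = 0 := by
    rw [hM]; field_simp; ring
  have hs := (sx3.hasSum.sub (sx2.hasSum.mul_left M)).sub
    ((sy3.hasSum.sub (sy2.hasSum.mul_left M)).mul_left (q ^ (M * (x - y))))
  rw [hMy, mul_zero, sub_zero] at hs
  have hfun : ∀ n, f q 3 x n - M * f q 2 x n - q ^ (M * (x - y)) * (f q 3 y n - M * f q 2 y n)
      = ((n : ℝ) + 1 - M) * f q 2 x n
        - q ^ (M * (x - y)) * (((n : ℝ) + 1 - M) * f q 2 y n) := by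
    intro n
    rw [f_three, f_three]
    ring
  simp only [hfun] at hs
  have hnn : ∀ n : ℕ, 0 ≤ ((n : ℝ) + 1 - M) * f q 2 x n
        - q ^ (M * (x - y)) * (((n : ℝ) + 1 - M) * f q 2 y n) := by
    intro n
    by_cases h : (n : ℝ) + 1 = M
    · simp [h]
    · exact (term_strict h0 h1 hxy M n h).le
  obtain ⟨i, hi⟩ : ∃ i : ℕ, (i : ℝ) + 1 ≠ M := by
    by_cases h : ((0 : ℕ) : ℝ) + 1 = M
    · refine ⟨1, ?_⟩
      rw [← h]
      norm_num
    · exact ⟨0, h⟩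
  have hpos := hs.summable.tsum_pos hnn i (term_strict h0 h1 hxy M i hi)
  rw [hs.tsum_eq] at hpos
  rw [lt_div_iff₀ px]
  linarith

end PsiAux

/-- for `q ∈ (0,1)`, the function `x ↦ Ψ_q'''(x)/Ψ_q''(x)` is strictly
increasing on `(0,∞)`. -/
theorem ratio_third_second_strictMono (q : ℝ) (hq : q ∈ Set.Ioo (0 : ℝ) 1) :
    StrictMonoOn (fun x : ℝ => PsiD q 3 x / PsiD q 2 x) (Set.Ioi 0) := by
  obtain ⟨h0, h1⟩ := hq
  have hL : Real.log q < 0 := Real.log_neg h0 h1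
  have key : ∀ x, PsiD q 3 x / PsiD q 2 x
      = Real.log q * ((∑' n, PsiAux.f q 3 x n) / (∑' n, PsiAux.f q 2 x n)) := by
    intro x
    change (Real.log q ^ 4 * (∑' n, PsiAux.f q 3 x n)) /
      (Real.log q ^ 3 * (∑' n, PsiAux.f q 2 x n)) = _
    rw [mul_div_mul_comm]
    congr 1
    have := hL.ne
    field_simp
  intro x hx y _ hxy
  simp only [key]
  exact mul_lt_mul_of_neg_left (PsiAux.main h0 h1 hx hxy) hL
end

section
/- Fix q ∈ (0,1), R > L ≥ 0 with R + L = 1, and θ > 0 with α = q^θ satisfying 2 − α < 1/q. For u ∈ [−π, π] let W(u) = Log(1 − (1−α)e^{iu}) / log q, so that q^{W(u)} traverses the circle of radius 1−α centered at 1. Then the function u ↦ Re f_0(W(u)) is strictly increasing on [0, π] and strictly decreasing on [−π, 0]. -/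
/-- The complex `q`-digamma function, defined by its series with `q^w = exp(w log q)`. -/
noncomputable def PsiC (q : ℝ) (z : ℂ) : ℂ :=
  -(Real.log (1 - q) : ℂ) + (Real.log q : ℂ) *
    ∑' k : ℕ, Complex.exp (((k : ℂ) + z) * (Real.log q : ℂ)) /
      (1 - Complex.exp (((k : ℂ) + z) * (Real.log q : ℂ)))

/-- `κ(θ) = ((1−q)/(log q)³)·((1−q^θ)²/q^θ)·((R/q)Ψ_q''(θ+1) − LΨ_q''(θ))`. -/
noncomputable def kappaF (q R L θ : ℝ) : ℝ :=
  ((1 - q) / Real.log q ^ 3) * ((1 - q ^ θ) ^ 2 / q ^ θ) *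
    ((R / q) * PsiD q 2 (θ + 1) - L * PsiD q 2 θ)

/-- `π(θ) = ((1−q)/(log q)²)·[(R/q)(Ψ_q'(θ+1) − ((1−α)/(α log q))Ψ_q''(θ+1))
  − L(Ψ_q'(θ) − ((1−α)/(α log q))Ψ_q''(θ))]` with `α = q^θ`. -/
noncomputable def piF (q R L θ : ℝ) : ℝ :=
  ((1 - q) / Real.log q ^ 2) *
    ((R / q) * (PsiD q 1 (θ + 1) - ((1 - q ^ θ) / (q ^ θ * Real.log q)) * PsiD q 2 (θ + 1))
      - L * (PsiD q 1 θ - ((1 - q ^ θ) / (q ^ θ * Real.log q)) * PsiD q 2 θ))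

/-- `f₀(Z) = κ(θ)·Log(1−q^Z) + ((1−q)/log q)((R/q)Ψ_q(Z+1) − LΨ_q(Z)) − Z log q (κ(θ)+π(θ))`,
with `q^Z = exp(Z log q)` and `Log` the principal complex logarithm. -/
noncomputable def f0 (q R L θ : ℝ) (Z : ℂ) : ℂ :=
  (kappaF q R L θ : ℂ) * Complex.log (1 - Complex.exp (Z * (Real.log q : ℂ)))
    + (((1 - q) / Real.log q : ℝ) : ℂ) * (((R / q : ℝ) : ℂ) * PsiC q (Z + 1) - (L : ℂ) * PsiC q Z)
    - Z * (Real.log q : ℂ) * ((kappaF q R L θ + piF q R L θ : ℝ) : ℂ)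


namespace SD

noncomputable def phi1 (t : ℝ) : ℝ := t / (1 - t) ^ 2
noncomputable def phi2 (t : ℝ) : ℝ := t * (1 + t) / (1 - t) ^ 3

lemma hs1 (t : ℝ) (h0 : 0 < t) (h1 : t < 1) :
    HasSum (fun n : ℕ => ((n : ℝ) + 1) ^ 1 * t ^ (n + 1)) (phi1 t) := by
  have hn : ‖t‖ < 1 := by rw [Real.norm_eq_abs, abs_of_pos h0]; exact h1
  have h := (hasSum_choose_mul_geometric_of_norm_lt_one 1 hn).mul_left t
  have e : t * (1 / (1 - t) ^ (1 + 1)) = phi1 t := by unfold phi1; ring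
  rw [e] at h
  refine h.congr_fun ?_
  intro n
  simp only [Nat.choose_one_right]
  push_cast; ring

lemma hs2 (t : ℝ) (h0 : 0 < t) (h1 : t < 1) :
    HasSum (fun n : ℕ => ((n : ℝ) + 1) ^ 2 * t ^ (n + 1)) (phi2 t) := by
  have hn : ‖t‖ < 1 := by rw [Real.norm_eq_abs, abs_of_pos h0]; exact h1
  have h := ((hasSum_choose_mul_geometric_of_norm_lt_one 2 hn).mul_left (2 * t)).sub (hs1 t h0 h1)
  have hne : 1 - t ≠ 0 := by linarith
  have e : 2 * t * (1 / (1 - t) ^ (2 + 1)) - phi1 t = phi2 t := by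
    unfold phi1 phi2; field_simp; ring
  rw [e] at h
  refine h.congr_fun ?_
  intro n
  rw [Nat.cast_choose_two]
  push_cast; ring

lemma psi_sum (q y : ℝ) (m : ℕ) (φ : ℝ → ℝ) (hq0 : 0 < q) (hq1 : q < 1) (hy0 : 0 < y) (hy1 : y < 1)
    (hφ : ∀ t : ℝ, 0 < t → t < 1 → HasSum (fun n : ℕ => ((n : ℝ) + 1) ^ m * t ^ (n + 1)) (φ t)) :
    HasSum (fun j : ℕ => φ (y * q ^ j))
      (∑' n : ℕ, ((n : ℝ) + 1) ^ m * y ^ (n + 1) / (1 - q ^ (n + 1))) := by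
  have hrow : ∀ n : ℕ, HasSum (fun j : ℕ => ((n : ℝ) + 1) ^ m * (y * q ^ j) ^ (n + 1))
      (((n : ℝ) + 1) ^ m * y ^ (n + 1) / (1 - q ^ (n + 1))) := by
    intro n
    have h := (hasSum_geometric_of_lt_one (r := q ^ (n + 1)) (by positivity)
      (pow_lt_one₀ hq0.le hq1 (by omega))).mul_left (((n : ℝ) + 1) ^ m * y ^ (n + 1))
    rw [← div_eq_mul_inv] at h
    refine h.congr_fun ?_
    intro j
    rw [mul_pow, ← pow_mul, ← pow_mul, mul_comm j]; ring
  have hsum : Summable (fun n : ℕ => ((n : ℝ) + 1) ^ m * y ^ (n + 1) / (1 - q ^ (n + 1))) := by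
    refine Summable.of_nonneg_of_le (fun n => ?_) (fun n => ?_) ((hφ y hy0 hy1).summable.mul_right (1 - q)⁻¹)
    · have : q ^ (n + 1) < 1 := pow_lt_one₀ hq0.le hq1 (by omega)
      have : 0 < 1 - q ^ (n + 1) := by linarith
      positivity
    · rw [← div_eq_mul_inv]
      have : q ^ (n + 1) ≤ q := pow_le_of_le_one hq0.le hq1.le (by omega)
      have : 0 < 1 - q := by linarith
      gcongr
  have hprod : Summable (fun p : ℕ × ℕ => ((p.1 : ℝ) + 1) ^ m * (y * q ^ p.2) ^ (p.1 + 1)) := by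
    rw [summable_prod_of_nonneg (fun p => by positivity)]
    refine ⟨fun n => (hrow n).summable, ?_⟩
    refine hsum.congr ?_
    intro n
    exact ((hrow n).tsum_eq).symm
  have hp := hprod.hasSum
  have e1 : ∑' p : ℕ × ℕ, ((p.1 : ℝ) + 1) ^ m * (y * q ^ p.2) ^ (p.1 + 1)
      = ∑' n : ℕ, ((n : ℝ) + 1) ^ m * y ^ (n + 1) / (1 - q ^ (n + 1)) :=
    (hp.prod_fiberwise hrow).tsum_eq.symm
  rw [e1] at hp
  have hp2 := (Equiv.prodComm ℕ ℕ).hasSum_iff.mpr hp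
  refine hp2.prod_fiberwise (fun j => ?_)
  have hlt : y * q ^ j < 1 := by
    have : q ^ j ≤ 1 := pow_le_one₀ hq0.le hq1.le
    nlinarith
  exact hφ (y * q ^ j) (by positivity) hlt

lemma psiD_sum (q x : ℝ) (k : ℕ) (φ : ℝ → ℝ) (hq0 : 0 < q) (hq1 : q < 1) (hx : 0 < x)
    (hφ : ∀ t : ℝ, 0 < t → t < 1 → HasSum (fun n : ℕ => ((n : ℝ) + 1) ^ k * t ^ (n + 1)) (φ t)) :
    Summable (fun j : ℕ => φ (q ^ x * q ^ j)) ∧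
    PsiD q k x = Real.log q ^ (k + 1) * ∑' j : ℕ, φ (q ^ x * q ^ j) := by
  have h := psi_sum q (q ^ x) k φ hq0 hq1 (Real.rpow_pos_of_pos hq0 _)
    (Real.rpow_lt_one hq0.le hq1 hx) hφ
  refine ⟨h.summable, ?_⟩
  rw [h.tsum_eq]
  unfold PsiD
  congr 2
  funext n
  rw [← Real.rpow_natCast (q ^ x), ← Real.rpow_mul hq0.le, mul_comm x]
  push_cast; rfl

/-- the combined summand -/
noncomputable def P (β t : ℝ) : ℝ := phi1 t - β * phi2 t

lemma P_eq (β x : ℝ) (h : 1 - x + x * β ≠ 0) :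
    P β ((1 - β) * x) = (1 - β) ^ 2 * x * (1 - x - x * β) / (1 - x + x * β) ^ 3 := by
  unfold P phi1 phi2
  have e : 1 - (1 - β) * x = 1 - x + x * β := by ring
  rw [e]
  field_simp
  ring

lemma kp (q R L θ : ℝ) (hq0 : 0 < q) (hq1 : q < 1) (hθ : 0 < θ) :
    Summable (fun j : ℕ => P (1 - q ^ θ) (q ^ θ * q ^ (j + 1))) ∧
    kappaF q R L θ + piF q R L θ = (1 - q) * ((R / q - L) *
      ∑' j : ℕ, P (1 - q ^ θ) (q ^ θ * q ^ (j + 1)) - L * P (1 - q ^ θ) (q ^ θ)) := by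
  obtain ⟨s10, e10⟩ := psiD_sum q θ 1 phi1 hq0 hq1 hθ hs1
  obtain ⟨s20, e20⟩ := psiD_sum q θ 2 phi2 hq0 hq1 hθ hs2
  obtain ⟨s11, e11⟩ := psiD_sum q (θ + 1) 1 phi1 hq0 hq1 (by linarith) hs1
  obtain ⟨s21, e21⟩ := psiD_sum q (θ + 1) 2 phi2 hq0 hq1 (by linarith) hs2
  have hsh : ∀ j : ℕ, q ^ (θ + 1) * q ^ j = q ^ θ * q ^ (j + 1) := by
    intro j; rw [Real.rpow_add hq0, Real.rpow_one]; ring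
  simp only [hsh] at s11 e11 s21 e21
  have hα : 0 < q ^ θ := Real.rpow_pos_of_pos hq0 _
  have hl : Real.log q ≠ 0 := (Real.log_neg hq0 hq1).ne
  have hP : HasSum (fun j : ℕ => P (1 - q ^ θ) (q ^ θ * q ^ (j + 1))) _ :=
    s11.hasSum.sub (s21.hasSum.mul_left (1 - q ^ θ))
  refine ⟨hP.summable, ?_⟩
  rw [hP.tsum_eq]
  rw [s10.tsum_eq_zero_add] at e10
  rw [s20.tsum_eq_zero_add] at e20
  unfold kappaF piF P
  rw [e10, e20, e11, e21]
  simp only [pow_zero, mul_one]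
  generalize ∑' j : ℕ, phi1 (q ^ θ * q ^ (j + 1)) = a
  generalize ∑' j : ℕ, phi2 (q ^ θ * q ^ (j + 1)) = b
  generalize phi1 (q ^ θ) = c
  generalize phi2 (q ^ θ) = d
  generalize q ^ θ = A at *
  generalize Real.log q = l at *
  field_simp
  ring

noncomputable def rr (x β c : ℝ) : ℝ := (1 - x + x * β * c) / ((1 - x) ^ 2 + (x * β) ^ 2 + 2 * (1 - x) * (x * β) * c) - 1

noncomputable def HH (x β c : ℝ) : ℝ := rr x β c - P β ((1 - β) * x) * (Real.log (1 + β ^ 2 - 2 * β * c) / 2)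

lemma HH_anti (x β : ℝ) (hx0 : 0 < x) (hb0 : 0 < β) (hb1 : β < 1) (hx : x * (1 + β) < 1) :
    StrictAntiOn (HH x β) (Set.Icc (-1) 1) := by
  have hB : 0 < x * β := by positivity
  have hAB : x * β < 1 - x := by linarith
  have hD : ∀ c ∈ Set.Icc (-1 : ℝ) 1, 0 < (1 - x) ^ 2 + (x * β) ^ 2 + 2 * (1 - x) * (x * β) * c := by
    intro c hc
    have h1 : 0 < (1 - x) * (x * β) := by apply mul_pos <;> linarith
    nlinarith [hc.1, mul_nonneg h1.le (by linarith [hc.1] : 0 ≤ c + 1), pow_pos (sub_pos.2 hAB) 2]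
  have hE : ∀ c ∈ Set.Icc (-1 : ℝ) 1, (1 - β) ^ 2 ≤ 1 + β ^ 2 - 2 * β * c := by
    intro c hc
    nlinarith [hc.2]
  have hder : ∀ c ∈ Set.Icc (-1 : ℝ) 1, HasDerivAt (HH x β)
      (((x * β) * ((1 - x) ^ 2 + (x * β) ^ 2 + 2 * (1 - x) * (x * β) * c) -
        (1 - x + x * β * c) * (2 * (1 - x) * (x * β))) /
        ((1 - x) ^ 2 + (x * β) ^ 2 + 2 * (1 - x) * (x * β) * c) ^ 2
        - P β ((1 - β) * x) * ((-(2 * β)) / (1 + β ^ 2 - 2 * β * c) / 2)) c := by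
    intro c hc
    have hE' : 0 < 1 + β ^ 2 - 2 * β * c := lt_of_lt_of_le (by nlinarith) (hE c hc)
    have d1 : HasDerivAt (fun c : ℝ => 1 - x + x * β * c) (x * β) c := by
      simpa using ((hasDerivAt_id c).const_mul (x * β)).const_add (1 - x)
    have d2 : HasDerivAt (fun c : ℝ => (1 - x) ^ 2 + (x * β) ^ 2 + 2 * (1 - x) * (x * β) * c)
        (2 * (1 - x) * (x * β)) c := by
      simpa using ((hasDerivAt_id c).const_mul (2 * (1 - x) * (x * β))).const_add
        ((1 - x) ^ 2 + (x * β) ^ 2)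
    have d3 : HasDerivAt (fun c : ℝ => 1 + β ^ 2 - 2 * β * c) (-(2 * β)) c := by
      simpa using ((hasDerivAt_id c).const_mul (2 * β)).const_sub (1 + β ^ 2)
    exact ((d1.div d2 (hD c hc).ne').sub_const 1).sub
      (((d3.log hE'.ne').div_const 2).const_mul _)
  refine strictAntiOn_of_deriv_neg (convex_Icc _ _)
    (fun c hc => (hder c hc).continuousAt.continuousWithinAt) ?_
  intro c hc
  rw [interior_Icc] at hc
  have hc' := Set.Ioo_subset_Icc_self hc
  rw [(hder c hc').deriv, P_eq β x (by linarith)]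
  have hD' := hD c hc'
  have hE1 : (1 - β) ^ 2 < 1 + β ^ 2 - 2 * β * c := by nlinarith [hc.2]
  have hD1 : (1 - x) ^ 2 + (x * β) ^ 2 + 2 * (1 - x) * (x * β) * c < (1 - x + x * β) ^ 2 := by
    have h1 : 0 < (1 - x) * (x * β) := by apply mul_pos <;> linarith
    nlinarith [mul_pos h1 (sub_pos.2 hc.2)]
  have hnum : (x * β) * ((1 - x) ^ 2 + (x * β) ^ 2 + 2 * (1 - x) * (x * β) * c) -
        (1 - x + x * β * c) * (2 * (1 - x) * (x * β)) =
        - ((x * β) * (1 - x - x * β) * (1 - x + x * β)) := by ring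
  rw [hnum]
  have hs : 0 < 1 - x + x * β := by linarith
  have hd : 0 < 1 - x - x * β := by linarith
  have hα2 : 0 < (1 - β) ^ 2 := by apply pow_pos; linarith
  generalize 1 + β ^ 2 - 2 * β * c = E at *
  generalize (1 - x) ^ 2 + (x * β) ^ 2 + 2 * (1 - x) * (x * β) * c = D at *
  generalize 1 - x + x * β = s at *
  generalize 1 - x - x * β = d at *
  have hE0 : 0 < E := by linarith
  have key : (1 - β) ^ 2 * D ^ 2 < s ^ 4 * E := by
    have h2 : D ^ 2 < s ^ 4 := by nlinarith
    nlinarith [pow_pos hD' 2]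
  have : -(x * β * d * s) / D ^ 2 - (1 - β) ^ 2 * x * d / s ^ 3 * (-(2 * β) / E / 2)
      = - (x * β * d * (s ^ 4 * E - (1 - β) ^ 2 * D ^ 2) / (D ^ 2 * s ^ 3 * E)) := by
    field_simp; ring
  rw [this, neg_lt_zero]
  have : 0 < s ^ 4 * E - (1 - β) ^ 2 * D ^ 2 := by linarith
  positivity

noncomputable def H0 (β c : ℝ) : ℝ := - (c / β) + P β (1 - β) * (Real.log (1 + β ^ 2 - 2 * β * c) / 2)

lemma H0_anti (β : ℝ) (hb0 : 0 < β) (hb1 : β < 1) :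
    AntitoneOn (H0 β) (Set.Icc (-1) 1) := by
  have hE : ∀ c ∈ Set.Icc (-1 : ℝ) 1, (1 - β) ^ 2 ≤ 1 + β ^ 2 - 2 * β * c := by
    intro c hc
    nlinarith [hc.2]
  have hder : ∀ c ∈ Set.Icc (-1 : ℝ) 1, HasDerivAt (H0 β)
      (- (1 / β) + P β (1 - β) * ((-(2 * β)) / (1 + β ^ 2 - 2 * β * c) / 2)) c := by
    intro c hc
    have hE' : 0 < 1 + β ^ 2 - 2 * β * c := lt_of_lt_of_le (by nlinarith) (hE c hc)
    have d3 : HasDerivAt (fun c : ℝ => 1 + β ^ 2 - 2 * β * c) (-(2 * β)) c := by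
      simpa using ((hasDerivAt_id c).const_mul (2 * β)).const_sub (1 + β ^ 2)
    exact (((hasDerivAt_id c).div_const β).neg).add
      (((d3.log hE'.ne').div_const 2).const_mul _)
  refine antitoneOn_of_deriv_nonpos (convex_Icc _ _)
    (fun c hc => (hder c hc).continuousAt.continuousWithinAt)
    (fun c hc => (hder c (interior_subset hc)).differentiableAt.differentiableWithinAt) ?_
  intro c hc
  have hc' := interior_subset hc
  have hP : P β (1 - β) = - ((1 - β) ^ 2 / β ^ 2) := by
    have := P_eq β 1 (by simpa using hb0.ne')
    rw [mul_one] at this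
    rw [this]; field_simp; ring
  rw [(hder c hc').deriv, hP]
  have hE1 := hE c hc'
  have hα2 : 0 < (1 - β) ^ 2 := by apply pow_pos; linarith
  generalize 1 + β ^ 2 - 2 * β * c = E at *
  have hE0 : 0 < E := by linarith
  have : -(1 / β) + -((1 - β) ^ 2 / β ^ 2) * (-(2 * β) / E / 2) = - ((E - (1 - β) ^ 2) / (β * E)) := by
    field_simp; ring
  rw [this, neg_nonpos]
  have : 0 ≤ E - (1 - β) ^ 2 := by linarith
  positivity

lemma re_term (x β u : ℝ) (h : (1 : ℂ) - (x : ℂ) * (1 - (β : ℂ) * Complex.exp (u * Complex.I)) ≠ 0) :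
    ((x : ℂ) * (1 - (β : ℂ) * Complex.exp (u * Complex.I)) /
      (1 - (x : ℂ) * (1 - (β : ℂ) * Complex.exp (u * Complex.I)))).re = rr x β (Real.cos u) := by
  set w : ℂ := 1 - (β : ℂ) * Complex.exp (u * Complex.I) with hw
  have e : (x : ℂ) * w / (1 - x * w) = (1 - x * w)⁻¹ - 1 := by field_simp; ring
  have hre : (1 - (x : ℂ) * w).re = 1 - x + x * β * Real.cos u := by
    simp [hw, Complex.exp_re, Complex.exp_im]; ring
  have him : (1 - (x : ℂ) * w).im = x * β * Real.sin u := by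
    simp [hw, Complex.exp_re, Complex.exp_im]
    try ring
  rw [e, Complex.sub_re, Complex.inv_re, Complex.one_re, Complex.normSq_apply, hre, him]
  unfold rr
  congr 2
  have := Real.sin_sq_add_cos_sq u
  linear_combination (x * β) ^ 2 * this

lemma re_log (β u : ℝ) :
    (Complex.log (1 - (β : ℂ) * Complex.exp (u * Complex.I))).re =
      Real.log (1 + β ^ 2 - 2 * β * Real.cos u) / 2 := by
  rw [Complex.log_re, Complex.norm_def, Real.log_sqrt (Complex.normSq_nonneg _)]
  congr 2
  rw [Complex.normSq_apply]
  simp [Complex.exp_re, Complex.exp_im]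
  have := Real.sin_sq_add_cos_sq u
  linear_combination (β) ^ 2 * this

set_option maxHeartbeats 1000000 in
lemma main_eq (q R L θ : ℝ) (hq0 : 0 < q) (hq1 : q < 1) (hθ : 0 < θ)
    (hα : 2 - q ^ θ < 1 / q) (u : ℝ) :
    Summable (fun k : ℕ => HH (q ^ (k + 1)) (1 - q ^ θ) (Real.cos u)) ∧
    (f0 q R L θ (Complex.log (1 - (1 - ((q ^ θ : ℝ) : ℂ)) * Complex.exp (u * Complex.I)) /
          (Real.log q : ℂ))).re =
      (kappaF q R L θ * Real.log (1 - q ^ θ) - (1 - q) / Real.log q * (R / q - L) * Real.log (1 - q)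
        + (1 - q) * L) + (1 - q) * ((R / q - L) *
        ∑' k : ℕ, HH (q ^ (k + 1)) (1 - q ^ θ) (Real.cos u) + L * H0 (1 - q ^ θ) (Real.cos u)) := by
  obtain ⟨hPs, hkp⟩ := kp q R L θ hq0 hq1 hθ
  have ha0 : 0 < q ^ θ := Real.rpow_pos_of_pos hq0 _
  have ha1 : q ^ θ < 1 := Real.rpow_lt_one hq0.le hq1 hθ
  have hl : Real.log q ≠ 0 := (Real.log_neg hq0 hq1).ne
  have hlC : (Real.log q : ℂ) ≠ 0 := by exact_mod_cast hl
  obtain ⟨β, hβ⟩ : ∃ β : ℝ, β = 1 - q ^ θ := ⟨_, rfl⟩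
  have hβC : (1 - ((q ^ θ : ℝ) : ℂ)) = (β : ℂ) := by rw [hβ]; push_cast; rfl
  have hαβ : q ^ θ = 1 - β := by rw [hβ]; ring
  have hx : q * (1 + β) < 1 := by
    rw [lt_div_iff₀ hq0] at hα
    rw [hβ]; nlinarith
  rw [hβC, ← hβ]
  rw [← hβ, hαβ] at hkp hPs
  have hb0 : 0 < β := by rw [hβ]; linarith
  have hb1 : β < 1 := by rw [hβ]; linarith
  have hlog := re_log β u
  have hnE : ‖Complex.exp (u * Complex.I)‖ = 1 := Complex.norm_exp_ofReal_mul_I u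
  have hterm := fun x => re_term x β u
  obtain ⟨w, hw⟩ : ∃ w : ℂ, w = 1 - (β : ℂ) * Complex.exp (u * Complex.I) := ⟨_, rfl⟩
  rw [← hw] at hlog ⊢
  simp only [← hw] at hterm
  have hbn : ‖(β : ℂ) * Complex.exp (u * Complex.I)‖ = β := by
    rw [norm_mul, hnE, mul_one, Complex.norm_real, Real.norm_eq_abs, abs_of_pos hb0]
  have h1w : 1 - w = (β : ℂ) * Complex.exp (u * Complex.I) := by rw [hw]; ring
  have hwn : ‖w‖ ≤ 1 + β := by
    have h := norm_sub_le (1 : ℂ) ((β : ℂ) * Complex.exp (u * Complex.I))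
    rw [hbn, norm_one, ← hw] at h
    exact h
  have hw0 : w ≠ 0 := by
    intro h0
    rw [h0, sub_zero] at h1w
    rw [← h1w, norm_one] at hbn
    linarith
  have hxk : ∀ k : ℕ, 1 - q * (1 + β) ≤ ‖1 - ((q ^ (k + 1) : ℝ) : ℂ) * w‖ := by
    intro k
    have h1 := norm_sub_norm_le (1 : ℂ) (((q ^ (k + 1) : ℝ) : ℂ) * w)
    have h2 : ‖((q ^ (k + 1) : ℝ) : ℂ) * w‖ ≤ q * (1 + β) := by
      rw [norm_mul, Complex.norm_real, Real.norm_eq_abs, abs_of_pos (by positivity)]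
      have : q ^ (k + 1) ≤ q := pow_le_of_le_one hq0.le hq1.le (by omega)
      gcongr
    rw [norm_one] at h1
    linarith
  have hne : ∀ k : ℕ, 1 - ((q ^ (k + 1) : ℝ) : ℂ) * w ≠ 0 := by
    intro k h
    have := hxk k
    rw [h, norm_zero] at this
    linarith
  have hS : Summable (fun k : ℕ => ((q ^ (k + 1) : ℝ) : ℂ) * w / (1 - ((q ^ (k + 1) : ℝ) : ℂ) * w)) := by
    refine Summable.of_norm_bounded (g := fun k : ℕ => q ^ k * (q * (1 + β) / (1 - q * (1 + β))))
      ((summable_geometric_of_lt_one hq0.le hq1).mul_right _) ?_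
    intro k
    have h0 : 0 < 1 - q * (1 + β) := by linarith
    rw [norm_div, norm_mul, Complex.norm_real, Real.norm_eq_abs, abs_of_pos (by positivity),
      ← mul_div_assoc, ← mul_assoc, ← pow_succ]
    gcongr
    exact hxk k
  have hexp : ∀ k : ℕ, Complex.exp (((k : ℂ) + Complex.log w / (Real.log q : ℂ)) * (Real.log q : ℂ))
      = ((q ^ k : ℝ) : ℂ) * w := by
    intro k
    rw [add_mul, div_mul_cancel₀ _ hlC, Complex.exp_add, Complex.exp_log hw0, Complex.exp_nat_mul,
      ← Complex.ofReal_exp, Real.exp_log hq0]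
    push_cast; rfl
  have hexp1 : ∀ k : ℕ, Complex.exp (((k : ℂ) + (Complex.log w / (Real.log q : ℂ) + 1)) * (Real.log q : ℂ))
      = ((q ^ (k + 1) : ℝ) : ℂ) * w := by
    intro k
    rw [← hexp]; congr 1; push_cast; ring
  have hPs1 : PsiC q (Complex.log w / (Real.log q : ℂ) + 1) = -(Real.log (1 - q) : ℂ) +
      (Real.log q : ℂ) * ∑' k : ℕ, ((q ^ (k + 1) : ℝ) : ℂ) * w / (1 - ((q ^ (k + 1) : ℝ) : ℂ) * w) := by
    unfold PsiC
    simp only [hexp1]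
  have hPs0 : PsiC q (Complex.log w / (Real.log q : ℂ)) = -(Real.log (1 - q) : ℂ) +
      (Real.log q : ℂ) * (w / (1 - w) +
        ∑' k : ℕ, ((q ^ (k + 1) : ℝ) : ℂ) * w / (1 - ((q ^ (k + 1) : ℝ) : ℂ) * w)) := by
    unfold PsiC
    simp only [hexp]
    have hS0 : Summable (fun k : ℕ => ((q ^ k : ℝ) : ℂ) * w / (1 - ((q ^ k : ℝ) : ℂ) * w)) :=
      (summable_nat_add_iff (f := fun k : ℕ => ((q ^ k : ℝ) : ℂ) * w / (1 - ((q ^ k : ℝ) : ℂ) * w))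
        1).mp hS
    rw [hS0.tsum_eq_zero_add]
    simp
  have hSre := Complex.hasSum_re hS.hasSum
  have hSre' : HasSum (fun k : ℕ => rr (q ^ (k + 1)) β (Real.cos u)) _ :=
    hSre.congr_fun (fun k => (hterm _ (hne k)).symm)
  have hHH : HasSum (fun k : ℕ => HH (q ^ (k + 1)) β (Real.cos u)) _ :=
    hSre'.sub (hPs.hasSum.mul_right (Real.log (1 + β ^ 2 - 2 * β * Real.cos u) / 2))
  refine ⟨hHH.summable, ?_⟩
  rw [hHH.tsum_eq]
  have hE0 : Complex.exp (Complex.log w / (Real.log q : ℂ) * (Real.log q : ℂ)) = w := by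
    rw [div_mul_cancel₀ _ hlC, Complex.exp_log hw0]
  unfold f0
  rw [hPs1, hPs0, hE0, div_mul_cancel₀ _ hlC, hkp]
  have hL1 : (Complex.log (1 - w)).re = Real.log β := by
    rw [Complex.log_re, h1w, hbn]
  have hw1 : (w / (1 - w)).re = Real.cos u / β - 1 := by
    have hne1 : 1 - w ≠ 0 := by
      rw [← norm_pos_iff, h1w, hbn]; exact hb0
    have e : w / (1 - w) = (1 - w)⁻¹ - 1 := by field_simp; ring
    rw [e, h1w, mul_inv, ← Complex.exp_neg, ← Complex.ofReal_inv, Complex.sub_re, Complex.re_ofReal_mul,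
      Complex.exp_re]
    simp
    ring
  unfold H0
  generalize (∑' k : ℕ, ((q ^ (k + 1) : ℝ) : ℂ) * w / (1 - ((q ^ (k + 1) : ℝ) : ℂ) * w)) = S
  generalize w / (1 - w) = V at *
  simp only [Complex.sub_re, Complex.add_re, Complex.re_ofReal_mul, Complex.re_mul_ofReal,
    Complex.neg_re, Complex.ofReal_re, hL1, hw1, hlog]
  field_simp
  ring

end SD

theorem steep_descent_C_contour (q R L θ : ℝ) (hq : q ∈ Set.Ioo (0 : ℝ) 1)
    (hL : 0 ≤ L) (hLR : L < R) (hRL : R + L = 1) (hθ : 0 < θ)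
    (hα : 2 - q ^ θ < 1 / q) :
    StrictMonoOn
      (fun u : ℝ => (f0 q R L θ
        (Complex.log (1 - (1 - ((q ^ θ : ℝ) : ℂ)) * Complex.exp (u * Complex.I)) /
          (Real.log q : ℂ))).re)
      (Set.Icc 0 Real.pi) ∧
    StrictAntiOn
      (fun u : ℝ => (f0 q R L θ
        (Complex.log (1 - (1 - ((q ^ θ : ℝ) : ℂ)) * Complex.exp (u * Complex.I)) /
          (Real.log q : ℂ))).re)
      (Set.Icc (-Real.pi) 0) := by
  obtain ⟨hq0, hq1⟩ := hq
  have ha0 : 0 < q ^ θ := Real.rpow_pos_of_pos hq0 _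
  have ha1 : q ^ θ < 1 := Real.rpow_lt_one hq0.le hq1 hθ
  have hm := SD.main_eq q R L θ hq0 hq1 hθ hα
  have hRq : 0 < R / q - L := by
    have : R ≤ R / q := by rw [le_div_iff₀ hq0]; nlinarith
    linarith
  have key : ∀ u v : ℝ, Real.cos v < Real.cos u →
      (f0 q R L θ (Complex.log (1 - (1 - ((q ^ θ : ℝ) : ℂ)) * Complex.exp (u * Complex.I)) /
          (Real.log q : ℂ))).re <
      (f0 q R L θ (Complex.log (1 - (1 - ((q ^ θ : ℝ) : ℂ)) * Complex.exp (v * Complex.I)) /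
          (Real.log q : ℂ))).re := by
    intro u v huv
    obtain ⟨su, eu⟩ := hm u
    obtain ⟨sv, ev⟩ := hm v
    rw [eu, ev]
    have hu : Real.cos u ∈ Set.Icc (-1 : ℝ) 1 := Real.cos_mem_Icc u
    have hv : Real.cos v ∈ Set.Icc (-1 : ℝ) 1 := Real.cos_mem_Icc v
    have h0 := SD.H0_anti (1 - q ^ θ) (by linarith) (by linarith) hv hu huv.le
    have hk : ∀ k : ℕ, SD.HH (q ^ (k + 1)) (1 - q ^ θ) (Real.cos u)
        < SD.HH (q ^ (k + 1)) (1 - q ^ θ) (Real.cos v) := by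
      intro k
      refine SD.HH_anti _ _ (by positivity) (by linarith) (by linarith) ?_ hv hu huv
      have : q ^ (k + 1) ≤ q := pow_le_of_le_one hq0.le hq1.le (by omega)
      rw [lt_div_iff₀ hq0] at hα
      nlinarith
    have hs := Summable.tsum_lt_tsum (fun k => (hk k).le) (hk 0) su sv
    have h1 := mul_lt_mul_of_pos_left hs hRq
    have h2 := mul_le_mul_of_nonneg_left h0 hL
    have h3 := mul_lt_mul_of_pos_left (add_lt_add_of_lt_of_le h1 h2) (sub_pos.2 hq1)
    linarith
  constructor
  · intro u hu v hv huv
    exact key u v (Real.strictAntiOn_cos hu hv huv)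
  · intro u hu v hv huv
    refine key v u ?_
    rw [← Real.cos_neg u, ← Real.cos_neg v]
    exact Real.strictAntiOn_cos ⟨by linarith [hv.2], by linarith [hv.1]⟩
      ⟨by linarith [hu.2], by linarith [hu.1]⟩ (by linarith)
end

section
/- Fix q ∈ (0,1), R > L ≥ 0 with R + L = 1, and θ > 0 with α = q^θ satisfying 2 − α < 1/q. For u ∈ ℝ let Z(u) = θ + i·u, so that q^{Z(u)} = α·e^{iu·log q}. Then the function u ↦ Re f_0(Z(u)) is strictly decreasing on [0, −π/log q] and strictly increasing on [π/log q, 0]. -/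
noncomputable def sT (x : ℝ) : ℝ := 2 * x / (1 - x) ^ 2
noncomputable def sg (x : ℝ) : ℝ := x * (1 + x) / (1 - x) ^ 3
noncomputable def sr (q x : ℝ) : ℝ :=
  q / (2 * (1 - q)) * (1 - (1 - q) * x / (1 - q * x)) * (1 - (1 - q) * x / (1 - q * x ^ 2))

lemma sr_anti (q x y : ℝ) (hq0 : 0 < q) (hq1 : q < 1) (hx : 0 < x) (hxy : x ≤ y) (hy : y < 1) :
    sr q y ≤ sr q x := by
  unfold sr
  have h1 : 0 < 1 - q := by linarith
  have a1 : 0 < 1 - q * y := by nlinarith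
  have a2 : 0 < 1 - q * y ^ 2 := by nlinarith
  have a3 : 0 < 1 - q * x := by nlinarith
  have a4 : 0 < 1 - q * x ^ 2 := by nlinarith
  have b1 : (1 - q) * x / (1 - q * x) ≤ (1 - q) * y / (1 - q * y) := by
    apply div_le_div₀ <;> first | positivity | nlinarith
  have hsq : x ^ 2 ≤ y ^ 2 := by nlinarith
  have b2 : (1 - q) * x / (1 - q * x ^ 2) ≤ (1 - q) * y / (1 - q * y ^ 2) := by
    apply div_le_div₀ <;> first | positivity | nlinarith
  have c1 : (1 - q) * y / (1 - q * y) ≤ 1 := by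
    rw [div_le_one a1]; nlinarith
  have c2 : (1 - q) * y / (1 - q * y ^ 2) ≤ 1 := by
    rw [div_le_one a2]; nlinarith [mul_pos hq0 (by linarith : 0 < y)]
  have : 0 ≤ q / (2 * (1 - q)) := by positivity
  gcongr
  · apply mul_nonneg this; linarith

lemma sg_eq (q x : ℝ) (hq0 : 0 < q) (hq1 : q < 1) (hx : 0 < x) (hy : x < 1) :
    sg (q * x) = sr q x * (sT x - sT (q * x)) := by
  unfold sr sg sT
  have h1 : 1 - q ≠ 0 := by linarith
  have h2 : 1 - x ≠ 0 := by linarith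
  have a3 : 1 - q * x ≠ 0 := by nlinarith
  have a4 : 1 - q * x ^ 2 ≠ 0 := by nlinarith
  field_simp
  ring

lemma sT_lt (x y : ℝ) (hx : 0 < x) (hxy : x < y) (hy : y < 1) : sT x < sT y := by
  unfold sT
  apply div_lt_div₀ <;> first | positivity | nlinarith

lemma sT_pos (x : ℝ) (hx : 0 < x) (hy : x < 1) : 0 < sT x := by
  unfold sT
  have : 0 < 1 - x := by linarith
  positivity

lemma sg_pos (x : ℝ) (hx : 0 < x) (hy : x < 1) : 0 < sg x := by
  unfold sg
  have : 0 < 1 - x := by linarith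
  positivity

lemma seq_lt (q a : ℝ) (hq0 : 0 < q) (hq1 : q < 1) (ha : 0 < a) (k : ℕ) :
    0 < a * q ^ k ∧ a * q ^ k ≤ a ∧ a * q ^ (k + 1) < a * q ^ k := by
  have := pow_pos hq0 k
  refine ⟨by positivity, ?_, ?_⟩
  · have := pow_le_one₀ (n := k) hq0.le hq1.le
    nlinarith
  · rw [pow_succ]
    have : 0 < a * q ^ k := by positivity
    nlinarith

lemma seq_summable (q a : ℝ) (hq0 : 0 < q) (hq1 : q < 1) :
    Summable (fun k : ℕ => a * q ^ (k + 1)) := by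
  have := (summable_geometric_of_lt_one hq0.le hq1).mul_left (a * q)
  refine this.congr fun k => ?_
  ring

lemma sg_le (x a : ℝ) (hx : 0 < x) (hxa : x ≤ a) (ha : a < 1) : sg x ≤ 2 / (1 - a) ^ 3 * x := by
  unfold sg
  have h : 0 < 1 - a := by linarith
  have h' : 1 - a ≤ 1 - x := by linarith
  have : x * (1 + x) / (1 - x) ^ 3 ≤ x * 2 / (1 - a) ^ 3 := by
    gcongr
    linarith
  calc _ ≤ _ := this
    _ = _ := by ring

lemma sg_summable (q a : ℝ) (hq0 : 0 < q) (hq1 : q < 1) (ha : 0 < a) (ha1 : a < 1) :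
    Summable (fun k : ℕ => sg (a * q ^ (k + 1))) := by
  refine Summable.of_nonneg_of_le (fun k => ?_) (fun k => ?_)
    ((seq_summable q a hq0 hq1).mul_left (2 / (1 - a) ^ 3))
  · have := seq_lt q a hq0 hq1 ha (k + 1)
    exact (sg_pos _ this.1 (by linarith)).le
  · have := seq_lt q a hq0 hq1 ha (k + 1)
    exact sg_le _ _ this.1 this.2.1 ha1

lemma tele (f : ℕ → ℝ) (hf : ∀ k, f (k + 1) ≤ f k) (h0 : Filter.Tendsto f Filter.atTop (nhds 0)) :
    HasSum (fun k => f k - f (k + 1)) (f 0) := by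
  rw [hasSum_iff_tendsto_nat_of_nonneg (fun k => sub_nonneg.2 (hf k))]
  simp_rw [Finset.sum_range_sub']
  simpa using h0.const_sub (f 0)

lemma seq_tendsto (q a : ℝ) (hq0 : 0 < q) (hq1 : q < 1) :
    Filter.Tendsto (fun k : ℕ => sT (a * q ^ k)) Filter.atTop (nhds 0) := by
  have h := (tendsto_pow_atTop_nhds_zero_of_lt_one hq0.le hq1).const_mul a
  rw [mul_zero] at h
  have hc : ContinuousAt sT 0 := by
    unfold sT
    apply ContinuousAt.div <;> first | fun_prop | norm_num
  have := hc.tendsto.comp h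
  simpa [sT, Function.comp_def] using this

lemma main_ineq (q a s : ℝ) (hq0 : 0 < q) (hq1 : q < 1) (ha : 0 < a) (ha1 : a < 1) (hs : 0 < s) :
    (∑' k : ℕ, sg (a * q ^ (k + 1))) / (1 + sT a * s) <
      ∑' k : ℕ, sg (a * q ^ (k + 1)) / (1 + sT (a * q ^ (k + 1)) * s) ^ 2 := by
  have hseq := seq_lt q a hq0 hq1 ha
  have hTp : ∀ k, 0 < sT (a * q ^ k) := fun k => sT_pos _ (hseq k).1 (by linarith [(hseq k).2.1])
  have hTl : ∀ k, sT (a * q ^ (k + 1)) < sT (a * q ^ k) := fun k =>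
    sT_lt _ _ (hseq (k+1)).1 (hseq k).2.2 (by linarith [(hseq k).2.1])
  have hgp : ∀ k, 0 < sg (a * q ^ k) := fun k => sg_pos _ (hseq k).1 (by linarith [(hseq k).2.1])
  have hgs := sg_summable q a hq0 hq1 ha ha1
  have hge : ∀ k, sg (a * q ^ (k + 1)) =
      sr q (a * q ^ k) * (sT (a * q ^ k) - sT (a * q ^ (k + 1))) := fun k => by
    have := sg_eq q (a * q ^ k) hq0 hq1 (hseq k).1 (by linarith [(hseq k).2.1])
    rw [show a * q ^ (k + 1) = q * (a * q ^ k) by ring]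
    exact this
  have hran : Monotone (fun k => sr q (a * q ^ k)) := monotone_nat_of_le_succ fun k =>
    sr_anti q _ _ hq0 hq1 (hseq (k+1)).1 (hseq k).2.2.le (by linarith [(hseq k).2.1])
  have ht := seq_tendsto q a hq0 hq1
  have hT0 : sT (a * q ^ 0) = sT a := by simp
  generalize hT : (fun k : ℕ => sT (a * q ^ k)) = T at *
  generalize hr : (fun k : ℕ => sr q (a * q ^ k)) = r at *
  have eT : ∀ k : ℕ, sT (a * q ^ k) = T k := fun k => by rw [← hT]
  have er : ∀ k : ℕ, sr q (a * q ^ k) = r k := fun k => by rw [← hr]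
  generalize hg : (fun k : ℕ => sg (a * q ^ k)) = g at *
  have eg : ∀ k : ℕ, sg (a * q ^ k) = g k := fun k => by rw [← hg]
  simp only [eT, er, eg] at *
  rw [← hT0]
  clear eT er eg hT hr hg
  have hP : ∀ k, 0 < 1 + T k * s := fun k => by have := hTp k; positivity
  have H1 : HasSum (fun k => T k - T (k + 1)) (T 0) := tele T (fun k => (hTl k).le) ht
  have H2 : HasSum (fun k => T k / (1 + T k * s) - T (k + 1) / (1 + T (k + 1) * s))
      (T 0 / (1 + T 0 * s)) := by
    apply tele (fun k => T k / (1 + T k * s))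
    · intro k
      rw [div_le_div_iff₀ (hP _) (hP _)]
      nlinarith [hTl k]
    · have : Filter.Tendsto (fun k => T k / (1 + T k * s)) Filter.atTop (nhds (0 / (1 + 0 * s))) :=
        ht.div ((ht.mul_const s).const_add 1) (by norm_num)
      simpa using this
  set A := 1 / (1 + T 0 * s) with hA
  have hAp : 0 < A := by have := hP 0; positivity
  have hA1 : A < 1 := by
    rw [hA, div_lt_one (hP 0)]; have := hTp 0; nlinarith [mul_pos this hs]
  let w : ℕ → ℝ := fun k => 1 / ((1 + T k * s) * (1 + T (k + 1) * s)) - A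
  have H3 : HasSum (fun k => (T k - T (k + 1)) * w k) 0 := by
    have := H2.sub (H1.mul_right A)
    rw [show T 0 / (1 + T 0 * s) - T 0 * A = 0 by rw [hA]; ring] at this
    have e : (fun k => (T k - T (k + 1)) * w k) = fun b =>
        T b / (1 + T b * s) - T (b + 1) / (1 + T (b + 1) * s) - (T b - T (b + 1)) * A := by
      funext k
      have h1 := (hP k).ne'
      have h2 := (hP (k+1)).ne'
      simp only [w]
      field_simp
      ring
    rw [e]
    exact this
  have hwm : Monotone w := by
    apply monotone_nat_of_le_succ
    intro k
    have h0 := hP k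
    have h1 := hP (k+1)
    have h2 := hP (k+1+1)
    have l1 := hTl k
    have l2 := hTl (k+1)
    simp only [w]
    gcongr
  have hwt : ∃ k, 0 ≤ w k := by
    have t1 : Filter.Tendsto (fun k => 1 / ((1 + T k * s) * (1 + T (k + 1) * s)) - A) Filter.atTop
        (nhds (1 / ((1 + 0 * s) * (1 + 0 * s)) - A)) := by
      refine Filter.Tendsto.sub_const (Filter.Tendsto.div tendsto_const_nhds ?_ (by norm_num)) A
      exact ((ht.mul_const s).const_add 1).mul
        ((((Filter.tendsto_add_atTop_iff_nat 1).2 ht).mul_const s).const_add 1)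
    have := t1.eventually_const_lt (u := 0) (by norm_num; linarith)
    obtain ⟨k, hk⟩ := this.exists
    exact ⟨k, hk.le⟩
  classical
  let N := Nat.find hwt
  have hsA : (∑' k, g (k + 1)) / (1 + T 0 * s) = ∑' k, g (k+1) * A := by
    rw [tsum_mul_right, hA]; ring
  have hs2 : Summable (fun k => g (k + 1) / (1 + T (k + 1) * s) ^ 2) := by
    refine Summable.of_nonneg_of_le (fun k => ?_) (fun k => ?_) hgs
    · have := hgp (k+1); positivity
    · apply div_le_self (hgp _).le
      have := hTp (k+1)
      have : 0 < T (k+1) * s := by positivity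
      nlinarith
  have hs3 := hgs.mul_right A
  rw [hsA, ← sub_pos, ← hs2.tsum_sub hs3]
  have key : ∀ k, r N * ((T k - T (k + 1)) * w k) <
      g (k + 1) / (1 + T (k + 1) * s) ^ 2 - g (k + 1) * A := by
    intro k
    have e1 : r N * ((T k - T (k + 1)) * w k) ≤ g (k + 1) * w k := by
      rw [hge]
      have hd : 0 < T k - T (k+1) := by linarith [hTl k]
      have : r N * w k ≤ r k * w k := by
        by_cases hk : k < N
        · have hw : w k < 0 := not_le.1 (Nat.find_min hwt hk)
          have := hran hk.le
          nlinarith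
        · push Not at hk
          have hw : 0 ≤ w k := (Nat.find_spec hwt).trans (hwm hk)
          have := hran hk
          nlinarith
      nlinarith
    have e2 : g (k + 1) * w k < g (k + 1) * (1 / (1 + T (k + 1) * s) ^ 2 - A) := by
      apply mul_lt_mul_of_pos_left _ (hgp _)
      simp only [w]
      have h0 := hP k
      have h1 := hP (k+1)
      have l1 := hTl k
      apply sub_lt_sub_right
      apply one_div_lt_one_div_of_lt (by positivity)
      rw [pow_two]
      gcongr
    calc _ ≤ _ := e1
      _ < _ := e2
      _ = _ := by ring
  have hz : (∑' k, r N * ((T k - T (k + 1)) * w k)) = 0 := by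
    rw [tsum_mul_left, H3.tsum_eq, mul_zero]
  rw [← hz]
  exact Summable.tsum_lt_tsum (i := 0) (fun k => (key k).le) (key 0) (H3.summable.mul_left _) (hs2.sub hs3)

noncomputable def sP (x s : ℝ) : ℝ := x * (1 - x - s) / ((1 - x) ^ 2 + 2 * x * s)

lemma sP_den (x s : ℝ) (hx : 0 < x) (hx1 : x < 1) (hs : 0 ≤ s) : 0 < (1 - x) ^ 2 + 2 * x * s := by
  have : 0 < 1 - x := by linarith
  positivity

lemma sP_cont (x : ℝ) (hx : 0 < x) (hx1 : x < 1) : ContinuousOn (sP x) (Set.Icc 0 2) := by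
  unfold sP
  apply ContinuousOn.div
  · fun_prop
  · fun_prop
  · intro s hs
    exact (sP_den x s hx hx1 hs.1).ne'

lemma sP_deriv (x s : ℝ) (hx : 0 < x) (hx1 : x < 1) (hs : 0 ≤ s) :
    HasDerivAt (sP x) (-(sg x / (1 + sT x * s) ^ 2)) s := by
  have hd := sP_den x s hx hx1 hs
  have h1 : HasDerivAt (fun s : ℝ => x * (1 - x - s)) (x * (-1)) s :=
    ((hasDerivAt_id s).const_sub (1 - x)).const_mul x
  have h2 : HasDerivAt (fun s : ℝ => (1 - x) ^ 2 + 2 * x * s) (2 * x * 1) s :=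
    ((hasDerivAt_id s).const_mul (2 * x)).const_add _
  have h3 := h1.div h2 hd.ne'
  refine h3.congr_deriv ?_
  unfold sg sT
  have : 0 < 1 - x := by linarith
  have e : 1 + 2 * x / (1 - x) ^ 2 * s = ((1 - x) ^ 2 + 2 * x * s) / (1 - x) ^ 2 := by
    field_simp
  rw [e]
  have hd' := hd.ne'
  generalize hD : (1 - x) ^ 2 + 2 * x * s = D at *
  have hs' : 2 * x * s = D - (1 - x) ^ 2 := by linarith
  field_simp
  linear_combination hs'

lemma sP_bound (x a s : ℝ) (hx : 0 < x) (hxa : x ≤ a) (ha : a < 1) (hs : s ∈ Set.Icc (0:ℝ) 2) :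
    ‖sP x s‖ ≤ 3 / (1 - a) ^ 2 * x := by
  obtain ⟨h0, h2⟩ := hs
  have hd := sP_den x s hx (by linarith) h0
  unfold sP
  rw [Real.norm_eq_abs, abs_div, abs_of_pos hd, abs_mul, abs_of_pos hx]
  have h1 : |1 - x - s| ≤ 3 := by rw [abs_le]; constructor <;> linarith
  have h1a : 0 < 1 - a := by linarith
  have h3 : (1 - a) ^ 2 ≤ (1 - x) ^ 2 + 2 * x * s := by
    have : 0 ≤ x * s := by positivity
    nlinarith
  calc x * |1 - x - s| / ((1 - x) ^ 2 + 2 * x * s) ≤ x * 3 / (1 - a) ^ 2 := by gcongr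
    _ = _ := by ring

noncomputable def sh (q R L a s : ℝ) : ℝ :=
  ((1 - q) * ((1 - a) ^ 2 / a) * ((R / q - L) * (∑' k : ℕ, sg (a * q ^ (k + 1))) - L * sg a)) *
    (1 / 2 * Real.log ((1 - a) ^ 2 + 2 * a * s)) +
  (1 - q) * ((R / q - L) * (∑' k : ℕ, sP (a * q ^ (k + 1)) s) - L * sP a s)

lemma sh_anti (q R L a : ℝ) (hq0 : 0 < q) (hq1 : q < 1) (hL : 0 ≤ L) (hLR : L < R)
    (ha : 0 < a) (ha1 : a < 1) : StrictAntiOn (sh q R L a) (Set.Icc 0 2) := by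
  have hseq := fun k => seq_lt q a hq0 hq1 ha k
  have hC : 0 < R / q - L := by
    have : R < R / q := by rw [lt_div_iff₀ hq0]; nlinarith
    linarith
  apply strictAntiOn_of_deriv_neg (convex_Icc 0 2)
  · unfold sh
    apply ContinuousOn.add
    · apply ContinuousOn.mul continuousOn_const
      apply ContinuousOn.mul continuousOn_const
      apply ContinuousOn.log
      · fun_prop
      · intro s hs
        exact (sP_den a s ha ha1 hs.1).ne'
    · apply ContinuousOn.mul continuousOn_const
      apply ContinuousOn.sub
      · apply ContinuousOn.mul continuousOn_const
        refine continuousOn_tsum (fun k => ?_) ((seq_summable q a hq0 hq1).mul_left (3 / (1 - a) ^ 2))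
          (fun k s hs => ?_)
        · exact sP_cont _ (hseq (k+1)).1 (by linarith [(hseq (k+1)).2.1])
        · exact sP_bound _ _ _ (hseq (k+1)).1 (hseq (k+1)).2.1 ha1 hs
      · exact continuousOn_const.mul (sP_cont a ha ha1)
  · intro s hs
    rw [interior_Icc] at hs
    have hd1 : HasDerivAt (fun s => ∑' k : ℕ, sP (a * q ^ (k + 1)) s)
        (∑' k : ℕ, -(sg (a * q ^ (k + 1)) / (1 + sT (a * q ^ (k + 1)) * s) ^ 2)) s := by
      refine hasDerivAt_tsum_of_isPreconnected (t := Set.Ioo 0 2) (y₀ := s)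
        (sg_summable q a hq0 hq1 ha ha1) isOpen_Ioo isPreconnected_Ioo
        (g := fun k s => sP (a * q ^ (k + 1)) s)
        (g' := fun k s => -(sg (a * q ^ (k + 1)) / (1 + sT (a * q ^ (k + 1)) * s) ^ 2))
        (fun k y hy => ?_) (fun k y hy => ?_) hs ?_ hs
      · exact sP_deriv _ _ (hseq (k+1)).1 (by linarith [(hseq (k+1)).2.1]) hy.1.le
      · have h1 := sg_pos _ (hseq (k+1)).1 (by linarith [(hseq (k+1)).2.1])
        have h2 := sT_pos _ (hseq (k+1)).1 (by linarith [(hseq (k+1)).2.1])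
        have h3 : 0 < sT (a * q ^ (k + 1)) * y := mul_pos h2 hy.1
        rw [norm_neg, Real.norm_eq_abs, abs_of_nonneg (by positivity)]
        apply div_le_self h1.le
        nlinarith
      · refine Summable.of_norm_bounded ((seq_summable q a hq0 hq1).mul_left (3 / (1 - a) ^ 2)) ?_
        intro k
        exact sP_bound _ _ _ (hseq (k+1)).1 (hseq (k+1)).2.1 ha1 ⟨hs.1.le, hs.2.le⟩
    have hden := sP_den a s ha ha1 hs.1.le
    have hd2 : HasDerivAt (fun s : ℝ => Real.log ((1 - a) ^ 2 + 2 * a * s))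
        (2 * a * 1 / ((1 - a) ^ 2 + 2 * a * s)) s :=
      (((hasDerivAt_id s).const_mul (2 * a)).const_add _).log hden.ne'
    have hd3 := sP_deriv a s ha ha1 hs.1.le
    have hd := ((hd2.const_mul (1 / 2)).const_mul ((1 - q) * ((1 - a) ^ 2 / a) *
      ((R / q - L) * (∑' k : ℕ, sg (a * q ^ (k + 1))) - L * sg a))).add
      (((hd1.const_mul (R / q - L)).sub (hd3.const_mul L)).const_mul (1 - q))
    have hd' : HasDerivAt (sh q R L a) _ s := hd
    rw [hd'.deriv, tsum_neg]
    have hm := main_ineq q a s hq0 hq1 ha ha1 hs.1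
    generalize (∑' k : ℕ, sg (a * q ^ (k + 1)) / (1 + sT (a * q ^ (k + 1)) * s) ^ 2) = S2 at *
    generalize (∑' k : ℕ, sg (a * q ^ (k + 1))) = S at *
    have hg := sg_pos a ha ha1
    have hT := sT_pos a ha ha1
    generalize sg a = g at *
    have h1a : 0 < 1 - a := by linarith
    have e : (1 - a) ^ 2 + 2 * a * s = (1 - a) ^ 2 * (1 + sT a * s) := by
      unfold sT; field_simp
    rw [e]
    have hTs : 0 < sT a * s := mul_pos hT hs.1
    generalize sT a * s = B at *
    have e2 : (1 - q) * ((1 - a) ^ 2 / a) * ((R / q - L) * S - L * g) *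
        (1 / 2 * (2 * a * 1 / ((1 - a) ^ 2 * (1 + B)))) +
        (1 - q) * ((R / q - L) * -S2 - L * -(g / (1 + B) ^ 2)) =
        (1 - q) * ((R / q - L) * (S / (1 + B) - S2) - L * g * (B / (1 + B) ^ 2)) := by
      field_simp
      ring
    rw [e2]
    have p1 : (R / q - L) * (S / (1 + B) - S2) < 0 := mul_neg_of_pos_of_neg hC (by linarith)
    have p2 : 0 ≤ L * g * (B / (1 + B) ^ 2) := by positivity
    apply mul_neg_of_pos_of_neg <;> linarith

lemma sq_geom (y : ℝ) (hy : 0 < y) (hy1 : y < 1) :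
    HasSum (fun n : ℕ => ((n : ℝ) + 1) ^ 2 * y ^ (n + 1)) (sg y) := by
  have hn : ‖y‖ < 1 := by rwa [Real.norm_eq_abs, abs_of_pos hy]
  have h2 := hasSum_choose_mul_geometric_of_norm_lt_one 2 hn
  have h1 := hasSum_choose_mul_geometric_of_norm_lt_one 1 hn
  have h := (h2.mul_left (2 * y)).sub (h1.mul_left y)
  have e : 2 * y * (1 / (1 - y) ^ (2 + 1)) - y * (1 / (1 - y) ^ (1 + 1)) = sg y := by
    have : 1 - y ≠ 0 := by linarith
    unfold sg
    field_simp
    ring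
  rw [e] at h
  have e2 : (fun n : ℕ => ((n : ℝ) + 1) ^ 2 * y ^ (n + 1)) = fun n : ℕ =>
      2 * y * (((n + 2).choose 2 : ℕ) * y ^ n) - y * (((n + 1).choose 1 : ℕ) * y ^ n) := by
    funext n
    rw [Nat.cast_choose_two, Nat.choose_one_right]
    push_cast
    ring
  rw [e2]
  exact h

lemma double_sum (q a : ℝ) (hq0 : 0 < q) (hq1 : q < 1) (ha : 0 < a) (ha1 : a < 1) :
    HasSum (fun n : ℕ => ((n : ℝ) + 1) ^ 2 * (a * q) ^ (n + 1) / (1 - q ^ (n + 1)))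
      (∑' k : ℕ, sg (a * q ^ (k + 1))) := by
  have hseq := fun k => seq_lt q a hq0 hq1 ha k
  obtain ⟨F, hFd⟩ : ∃ F : ℕ × ℕ → ℝ, ∀ p, F p =
    ((p.2 : ℝ) + 1) ^ 2 * (a * q ^ (p.1 + 1)) ^ (p.2 + 1) := ⟨_, fun _ => rfl⟩
  have h1 : ∀ k, HasSum (fun n => F (k, n)) (sg (a * q ^ (k + 1))) := fun k => by
    simp only [hFd]
    exact sq_geom _ (hseq (k+1)).1 (by linarith [(hseq (k+1)).2.1])
  have hF : Summable F := by
    rw [summable_prod_of_nonneg (fun p => by rw [hFd]; simp only [Pi.zero_apply]; positivity)]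
    refine ⟨fun k => (h1 k).summable, ?_⟩
    simp_rw [fun k => (h1 k).tsum_eq]
    exact sg_summable q a hq0 hq1 ha ha1
  have h2 : ∀ n, HasSum (fun k => F (k, n))
      (((n : ℝ) + 1) ^ 2 * (a * q) ^ (n + 1) / (1 - q ^ (n + 1))) := fun n => by
    have hp : q ^ (n + 1) < 1 := pow_lt_one₀ hq0.le hq1 (by omega)
    have := (hasSum_geometric_of_lt_one (pow_pos hq0 (n+1)).le hp).mul_left
      (((n : ℝ) + 1) ^ 2 * (a * q) ^ (n + 1))
    have e : (fun k => F (k, n)) = fun k => ((n : ℝ) + 1) ^ 2 * (a * q) ^ (n + 1) * (q ^ (n+1)) ^ k := by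
      funext k
      simp only [hFd]
      rw [pow_succ q k]
      simp only [mul_pow]
      rw [← pow_mul, ← pow_mul, mul_comm k (n+1)]
      ring
    rw [e, div_eq_mul_inv]
    exact this
  have h3 : HasSum F (∑' k : ℕ, sg (a * q ^ (k + 1))) := by
    have := hF.hasSum
    rw [hF.tsum_prod] at this
    simpa only [fun k => (h1 k).tsum_eq] using this
  have h4 : HasSum (fun p : ℕ × ℕ => F p.swap) (∑' k : ℕ, sg (a * q ^ (k + 1))) :=
    (Equiv.prodComm ℕ ℕ).hasSum_iff.2 h3
  exact h4.prod_fiberwise h2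

lemma rpow_term (q θ : ℝ) (hq0 : 0 < q) (n : ℕ) : q ^ (((n : ℝ) + 1) * θ) = (q ^ θ) ^ (n + 1) := by
  rw [mul_comm, Real.rpow_mul hq0.le, ← Real.rpow_natCast]
  push_cast
  rfl

lemma kappa_eq (q R L θ : ℝ) (hq0 : 0 < q) (hq1 : q < 1) (hθ : 0 < θ) :
    kappaF q R L θ = (1 - q) * ((1 - q ^ θ) ^ 2 / q ^ θ) *
      ((R / q - L) * (∑' k : ℕ, sg (q ^ θ * q ^ (k + 1))) - L * sg (q ^ θ)) := by
  have ha : 0 < q ^ θ := Real.rpow_pos_of_pos hq0 _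
  have ha1 : q ^ θ < 1 := Real.rpow_lt_one hq0.le hq1 hθ
  have e1 : q ^ (θ + 1) = q ^ θ * q := by rw [Real.rpow_add hq0, Real.rpow_one]
  have hl : Real.log q ≠ 0 := (Real.log_neg hq0 hq1).ne
  have hD := double_sum q _ hq0 hq1 ha ha1
  have hS := (sq_geom _ ha ha1).add hD
  have hS' : (fun n : ℕ => ((n : ℝ) + 1) ^ 2 * (q ^ θ) ^ (n + 1) +
      ((n : ℝ) + 1) ^ 2 * (q ^ θ * q) ^ (n + 1) / (1 - q ^ (n + 1))) =
      fun n : ℕ => ((n : ℝ) + 1) ^ 2 * (q ^ θ) ^ (n + 1) / (1 - q ^ (n + 1)) := by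
    funext n
    have hp : q ^ (n + 1) < 1 := pow_lt_one₀ hq0.le hq1 (by omega)
    have : 1 - q ^ (n + 1) ≠ 0 := by linarith
    rw [mul_pow]
    field_simp
    ring
  rw [hS'] at hS
  unfold kappaF PsiD
  simp only [rpow_term q _ hq0, e1, hD.tsum_eq, hS.tsum_eq]
  field_simp
  ring

lemma exp_term (q θ u : ℝ) (hq0 : 0 < q) (k : ℕ) :
    Complex.exp (((k : ℂ) + ((θ : ℂ) + u * Complex.I)) * (Real.log q : ℂ)) =
      ((q ^ θ * q ^ k : ℝ) : ℂ) * Complex.exp ((u * Real.log q : ℝ) * Complex.I) := by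
  have : (q ^ θ * q ^ k : ℝ) = Real.exp ((k + θ) * Real.log q) := by
    rw [← Real.rpow_natCast, ← Real.rpow_add hq0, Real.rpow_def_of_pos hq0]
    congr 1; ring
  rw [this, Complex.ofReal_exp, ← Complex.exp_add]
  congr 1
  push_cast
  ring

lemma re_term (x φ : ℝ) (hx : 0 < x) (hx1 : x < 1) :
    ((x : ℂ) * Complex.exp (φ * Complex.I) / (1 - (x : ℂ) * Complex.exp (φ * Complex.I))).re =
      sP x (1 - Real.cos φ) := by
  have h := sP_den x (1 - Real.cos φ) hx hx1 (by linarith [Real.cos_le_one φ])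
  have hn : Complex.normSq (1 - (x : ℂ) * Complex.exp (φ * Complex.I)) =
      (1 - x) ^ 2 + 2 * x * (1 - Real.cos φ) := by
    simp [Complex.normSq_apply, Complex.exp_ofReal_mul_I_re, Complex.exp_ofReal_mul_I_im]
    linear_combination x ^ 2 * Real.sin_sq_add_cos_sq φ
  rw [Complex.div_re, hn]
  unfold sP
  simp [Complex.exp_ofReal_mul_I_re, Complex.exp_ofReal_mul_I_im]
  rw [← add_div]
  congr 1
  linear_combination (-x ^ 2) * Real.sin_sq_add_cos_sq φ

lemma log_term (x φ : ℝ) (hx : 0 < x) (hx1 : x < 1) :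
    (Complex.log (1 - (x : ℂ) * Complex.exp (φ * Complex.I))).re =
      1 / 2 * Real.log ((1 - x) ^ 2 + 2 * x * (1 - Real.cos φ)) := by
  have hn : Complex.normSq (1 - (x : ℂ) * Complex.exp (φ * Complex.I)) =
      (1 - x) ^ 2 + 2 * x * (1 - Real.cos φ) := by
    simp [Complex.normSq_apply, Complex.exp_ofReal_mul_I_re, Complex.exp_ofReal_mul_I_im]
    linear_combination x ^ 2 * Real.sin_sq_add_cos_sq φ
  rw [Complex.log_re, ← hn, Complex.normSq_eq_norm_sq, Real.log_pow]
  push_cast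
  ring

lemma csummable (q a φ : ℝ) (hq0 : 0 < q) (hq1 : q < 1) (ha : 0 < a) (ha1 : a < 1) :
    Summable (fun k : ℕ => ((a * q ^ k : ℝ) : ℂ) * Complex.exp (φ * Complex.I) /
      (1 - ((a * q ^ k : ℝ) : ℂ) * Complex.exp (φ * Complex.I))) := by
  refine Summable.of_norm_bounded
    (((summable_geometric_of_lt_one hq0.le hq1).mul_left a).mul_left (1 / (1 - a))) ?_
  intro k
  obtain ⟨h1, h2, -⟩ := seq_lt q a hq0 hq1 ha k
  have hn : ‖((a * q ^ k : ℝ) : ℂ) * Complex.exp (φ * Complex.I)‖ = a * q ^ k := by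
    rw [norm_mul, Complex.norm_exp_ofReal_mul_I, mul_one, Complex.norm_real, Real.norm_eq_abs,
      abs_of_pos h1]
  have hd := norm_sub_norm_le (1 : ℂ) (((a * q ^ k : ℝ) : ℂ) * Complex.exp (φ * Complex.I))
  rw [hn, norm_one] at hd
  rw [norm_div, hn]
  have : 0 < 1 - a := by linarith
  calc _ ≤ a * q ^ k / (1 - a) := by
        gcongr
        linarith
    _ = _ := by ring

lemma f0_re (q R L θ : ℝ) (hq0 : 0 < q) (hq1 : q < 1) (hθ : 0 < θ) :
    ∃ c : ℝ, ∀ u : ℝ, (f0 q R L θ ((θ : ℂ) + u * Complex.I)).re =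
      sh q R L (q ^ θ) (1 - Real.cos (u * Real.log q)) + c := by
  have ha : 0 < q ^ θ := Real.rpow_pos_of_pos hq0 _
  have ha1 : q ^ θ < 1 := Real.rpow_lt_one hq0.le hq1 hθ
  have hl : Real.log q ≠ 0 := (Real.log_neg hq0 hq1).ne
  refine ⟨(1 - q) / Real.log q * (R / q - L) * (-Real.log (1 - q)) -
    θ * Real.log q * (kappaF q R L θ + piF q R L θ), fun u => ?_⟩
  have hseq := fun k => seq_lt q _ hq0 hq1 ha k
  have hs := csummable q (q ^ θ) (u * Real.log q) hq0 hq1 ha ha1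
  have hs1 := (summable_nat_add_iff 1).2 hs
  have P0 : (PsiC q ((θ : ℂ) + u * Complex.I)).re = -Real.log (1 - q) + Real.log q *
      (sP (q ^ θ) (1 - Real.cos (u * Real.log q)) +
        ∑' k : ℕ, sP (q ^ θ * q ^ (k + 1)) (1 - Real.cos (u * Real.log q))) := by
    unfold PsiC
    simp only [exp_term q θ u hq0]
    rw [Complex.add_re, Complex.neg_re, Complex.ofReal_re, Complex.re_ofReal_mul, Complex.re_tsum hs]
    have e : ∀ k : ℕ, (((q ^ θ * q ^ k : ℝ) : ℂ) * Complex.exp ((u * Real.log q : ℝ) * Complex.I) /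
      (1 - ((q ^ θ * q ^ k : ℝ) : ℂ) * Complex.exp ((u * Real.log q : ℝ) * Complex.I))).re =
      sP (q ^ θ * q ^ k) (1 - Real.cos (u * Real.log q)) := fun k =>
      re_term _ _ (hseq k).1 (by linarith [(hseq k).2.1])
    have hsr := Complex.reCLM.summable hs
    simp only [Complex.reCLM_apply, e] at hsr
    simp only [e]
    rw [hsr.tsum_eq_zero_add]
    simp only [pow_zero, mul_one]
  have P1 : (PsiC q ((θ : ℂ) + u * Complex.I + 1)).re = -Real.log (1 - q) + Real.log q *
      (∑' k : ℕ, sP (q ^ θ * q ^ (k + 1)) (1 - Real.cos (u * Real.log q))) := by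
    unfold PsiC
    have e0 : ∀ k : ℕ, (k : ℂ) + ((θ : ℂ) + u * Complex.I + 1) =
        ((k + 1 : ℕ) : ℂ) + ((θ : ℂ) + u * Complex.I) := fun k => by push_cast; ring
    simp only [e0, exp_term q θ u hq0]
    rw [Complex.add_re, Complex.neg_re, Complex.ofReal_re, Complex.re_ofReal_mul, Complex.re_tsum hs1]
    have e : ∀ k : ℕ, (((q ^ θ * q ^ k : ℝ) : ℂ) * Complex.exp ((u * Real.log q : ℝ) * Complex.I) /
      (1 - ((q ^ θ * q ^ k : ℝ) : ℂ) * Complex.exp ((u * Real.log q : ℝ) * Complex.I))).re =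
      sP (q ^ θ * q ^ k) (1 - Real.cos (u * Real.log q)) := fun k =>
      re_term _ _ (hseq k).1 (by linarith [(hseq k).2.1])
    simp only [e]
  have E0 : Complex.exp (((θ : ℂ) + u * Complex.I) * (Real.log q : ℂ)) =
      ((q ^ θ : ℝ) : ℂ) * Complex.exp ((u * Real.log q : ℝ) * Complex.I) := by
    simpa using exp_term q θ u hq0 0
  have Z0 : (((θ : ℂ) + u * Complex.I) * (Real.log q : ℂ) *
      ((kappaF q R L θ + piF q R L θ : ℝ) : ℂ)).re =
      θ * Real.log q * (kappaF q R L θ + piF q R L θ) := by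
    rw [Complex.re_mul_ofReal, Complex.re_mul_ofReal]
    simp
  unfold f0
  rw [Complex.sub_re, Z0, Complex.add_re, Complex.re_ofReal_mul, Complex.re_ofReal_mul,
    Complex.sub_re, Complex.re_ofReal_mul, Complex.re_ofReal_mul, P0, P1, E0,
    log_term _ _ ha ha1]
  unfold sh
  rw [← kappa_eq q R L θ hq0 hq1 hθ]
  field_simp
  ring

/-- steep descent of `Re f₀` along the vertical contour `𝒟_α`,
`Z(u) = θ + iu` (so that `q^{Z(u)} = α e^{iu log q}` with `α = q^θ`):
`u ↦ Re f₀(Z(u))` is strictly decreasing on `[0, −π/log q]` and strictly increasing on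
`[π/log q, 0]`. -/
theorem steep_descent_D_contour (q R L θ : ℝ) (hq : q ∈ Set.Ioo (0 : ℝ) 1)
    (hL : 0 ≤ L) (hLR : L < R) (hRL : R + L = 1) (hθ : 0 < θ)
    (hα : 2 - q ^ θ < 1 / q) :
    StrictAntiOn (fun u : ℝ => (f0 q R L θ ((θ : ℂ) + u * Complex.I)).re)
      (Set.Icc 0 (-Real.pi / Real.log q)) ∧
    StrictMonoOn (fun u : ℝ => (f0 q R L θ ((θ : ℂ) + u * Complex.I)).re)
      (Set.Icc (Real.pi / Real.log q) 0) := by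
  obtain ⟨hq0, hq1⟩ := hq
  have ha : 0 < q ^ θ := Real.rpow_pos_of_pos hq0 _
  have ha1 : q ^ θ < 1 := Real.rpow_lt_one hq0.le hq1 hθ
  have hl := Real.log_neg hq0 hq1
  obtain ⟨c, hc⟩ := f0_re q R L θ hq0 hq1 hθ
  have hA := sh_anti q R L _ hq0 hq1 hL hLR ha ha1
  have hmem : ∀ φ : ℝ, 1 - Real.cos φ ∈ Set.Icc (0:ℝ) 2 := fun φ =>
    ⟨by linarith [Real.cos_le_one φ], by linarith [Real.neg_one_le_cos φ]⟩
  constructor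
  · intro u hu v hv huv
    simp only [hc]
    rw [Set.mem_Icc, le_div_iff_of_neg hl] at hu hv
    have := Real.strictAntiOn_cos (a := -(u * Real.log q)) (b := -(v * Real.log q))
      ⟨by nlinarith, by linarith⟩ ⟨by nlinarith, by linarith⟩ (by nlinarith)
    rw [Real.cos_neg, Real.cos_neg] at this
    have := hA (hmem (u * Real.log q)) (hmem (v * Real.log q)) (by linarith)
    linarith
  · intro u hu v hv huv
    simp only [hc]
    rw [Set.mem_Icc, div_le_iff_of_neg hl] at hu hv
    have := Real.strictAntiOn_cos (a := v * Real.log q) (b := u * Real.log q)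
      ⟨by nlinarith, by linarith⟩ ⟨by nlinarith, by linarith⟩ (by nlinarith)
    have := hA (hmem (v * Real.log q)) (hmem (u * Real.log q)) (by linarith)
    linarith
end

section
/- Fix q ∈ (0,1), let R ∈ (1/2, 1) and L = 1 − R. Then there exists a unique θ₀ > 0 such that (R/q)·Ψ_q''(θ₀ + 1) = L·Ψ_q''(θ₀) (equivalently, κ_{q,q,R}(θ₀) = 0, where κ_{q,q,R}(θ) = ((1−q)/(log q)³)·((1−q^θ)²/q^θ)·((R/q)·Ψ_q''(θ+1) − L·Ψ_q''(θ))). Moreover, setting θ_m = log(2q/(1+q))/log(q), one has θ₀ < θ_m (equivalently q^{θ₀} > 2q/(1+q)) if and only if R > q·Ψ_q''(θ_m) / ( q·Ψ_q''(θ_m) + Ψ_q''(θ_m + 1) ). -/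
noncomputable def aT (q x : ℝ) (n : ℕ) : ℝ :=
  ((n : ℝ) + 1) ^ 2 * q ^ (((n : ℝ) + 1) * x) / (1 - q ^ (n + 1))

noncomputable def sS (q x : ℝ) : ℝ := ∑' n : ℕ, aT q x n

section
variable {q : ℝ} (h0 : 0 < q) (h1 : q < 1)
include h0 h1

theorem den_pos (n : ℕ) : 0 < 1 - q ^ (n + 1) := by
  have := pow_lt_one₀ h0.le h1 (Nat.succ_ne_zero n)
  simpa using this

theorem aT_pos (x : ℝ) (n : ℕ) : 0 < aT q x n := by
  have := den_pos h0 h1 n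
  unfold aT
  positivity

theorem aT_anti {x y : ℝ} (h : x ≤ y) (n : ℕ) : aT q y n ≤ aT q x n := by
  have := den_pos h0 h1 n
  have h2 : q ^ (((n : ℝ) + 1) * y) ≤ q ^ (((n : ℝ) + 1) * x) :=
    Real.rpow_le_rpow_of_exponent_ge h0 h1.le (by gcongr)
  unfold aT
  gcongr

theorem aT_shift (x d : ℝ) (n : ℕ) : aT q (x + d) n = aT q x n * q ^ (((n : ℝ) + 1) * d) := by
  unfold aT
  rw [mul_add, Real.rpow_add h0]; ring

theorem aT_succ (x : ℝ) (n : ℕ) : aT q (x + 1) n = aT q x n * q ^ (n + 1) := by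
  rw [aT_shift h0 h1, mul_one, ← Real.rpow_natCast]; push_cast; rfl

theorem aT_summable {x : ℝ} (hx : 0 < x) : Summable (aT q x) := by
  have hr : q ^ x < 1 := Real.rpow_lt_one h0.le h1 hx
  have hr0 : 0 < q ^ x := Real.rpow_pos_of_pos h0 x
  have hs : Summable (fun n : ℕ => (n : ℝ) ^ 2 * (q ^ x) ^ n) :=
    summable_pow_mul_geometric_of_norm_lt_one 2 (by rwa [Real.norm_of_nonneg hr0.le])
  have hs2 := ((summable_nat_add_iff 1).2 hs).mul_right (1 / (1 - q))
  refine Summable.of_nonneg_of_le (fun n => (aT_pos h0 h1 x n).le) (fun n => ?_) hs2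
  have h3 : q ^ (((n : ℝ) + 1) * x) = (q ^ x) ^ (n + 1) := by
    rw [mul_comm, Real.rpow_mul h0.le, ← Real.rpow_natCast]; push_cast; rfl
  have h4 : 1 - q ≤ 1 - q ^ (n + 1) := by
    have : q ^ (n + 1) ≤ q ^ 1 := pow_le_pow_of_le_one h0.le h1.le (by omega)
    linarith [pow_one q]
  unfold aT
  rw [h3, div_eq_mul_one_div]
  push_cast
  have : 0 < 1 - q := by linarith
  gcongr

theorem sS_pos {x : ℝ} (hx : 0 < x) : 0 < sS q x :=
  (aT_summable h0 h1 hx).tsum_pos (fun n => (aT_pos h0 h1 x n).le) 0 (aT_pos h0 h1 x 0)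

theorem sS_anti {x y : ℝ} (hx : 0 < x) (h : x ≤ y) : sS q y ≤ sS q x :=
  (aT_summable h0 h1 (hx.trans_le h)).tsum_le_tsum (fun n => aT_anti h0 h1 h n)
    (aT_summable h0 h1 hx)

theorem sS_cont : ContinuousOn (sS q) (Set.Ioi 0) := by
  intro x hx
  have hx' : 0 < x / 2 := half_pos hx
  have : ContinuousOn (sS q) (Set.Ici (x / 2)) := by
    refine continuousOn_tsum (u := aT q (x / 2)) (fun n => ?_) (aT_summable h0 h1 hx') ?_
    · have : Continuous fun y => aT q y n := by
        unfold aT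
        refine Continuous.div_const (continuous_const.mul ?_) _
        exact (Real.continuous_const_rpow h0.ne').comp (by fun_prop)
      exact this.continuousOn
    · intro n y hy
      rw [Real.norm_of_nonneg (aT_pos h0 h1 y n).le]
      exact aT_anti h0 h1 hy n
  refine (this.continuousAt (Ici_mem_nhds ?_)).continuousWithinAt
  have : 0 < x := hx
  linarith

theorem sS_key {x y c : ℝ} (hx : 0 < x) (hxy : x < y) (hc : 0 < c)
    (h : c * sS q x ≤ sS q (x + 1)) (hcq : c ≤ sS q (x + 1) / sS q x) :
    sS q (x + 1) = c * sS q x → c * sS q y < sS q (y + 1) := by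
  intro he
  obtain ⟨t, rfl⟩ : ∃ t : ℝ, q ^ t = c :=
    ⟨Real.log c / Real.log q, by
      rw [Real.rpow_def_of_pos h0, mul_div_cancel₀ _ (Real.log_neg h0 h1).ne, Real.exp_log hc]⟩
  set c := q ^ t with hcdef
  have hd : 0 < y - x := by linarith
  set b := q ^ (t * (y - x)) with hb
  have hy : 0 < y := hx.trans hxy
  have sx := aT_summable h0 h1 hx
  have sx1 := aT_summable h0 h1 (show 0 < x + 1 by linarith)
  have sy := aT_summable h0 h1 hy
  have sy1 := aT_summable h0 h1 (show 0 < y + 1 by linarith)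
  have hs := (sy1.hasSum.sub (sy.hasSum.mul_left c)).sub
    ((sx1.hasSum.sub (sx.hasSum.mul_left c)).mul_left b)
  have hf : ∀ n, (aT q (y + 1) n - c * aT q y n - b * (aT q (x + 1) n - c * aT q x n)) =
      aT q x n * ((q ^ ((n : ℝ) + 1) - q ^ t) *
        (q ^ (((n : ℝ) + 1) * (y - x)) - q ^ (t * (y - x)))) := by
    intro n
    have e1 : aT q y n = aT q x n * q ^ (((n : ℝ) + 1) * (y - x)) := by
      rw [← aT_shift h0 h1]; congr 1; ring
    have e2 : q ^ ((n : ℝ) + 1) = q ^ (n + 1) := by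
      rw [← Real.rpow_natCast]; push_cast; rfl
    rw [aT_succ h0 h1, aT_succ h0 h1, e1, e2]; ring
  have hpos : ∀ n : ℕ, (n : ℝ) + 1 ≠ t →
      0 < aT q (y + 1) n - c * aT q y n - b * (aT q (x + 1) n - c * aT q x n) := by
    intro n hn
    rw [hf]
    refine mul_pos (aT_pos h0 h1 x n) ?_
    rcases lt_or_gt_of_ne hn with hn | hn
    · apply mul_pos <;> rw [sub_pos] <;> apply Real.rpow_lt_rpow_of_exponent_gt h0 h1
      · exact hn
      · gcongr
    · apply mul_pos_of_neg_of_neg <;> rw [sub_neg] <;> apply Real.rpow_lt_rpow_of_exponent_gt h0 h1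
      · exact hn
      · gcongr
  have hnn : ∀ n : ℕ,
      0 ≤ aT q (y + 1) n - c * aT q y n - b * (aT q (x + 1) n - c * aT q x n) := by
    intro n
    by_cases hn : (n : ℝ) + 1 = t
    · rw [hf, hn]; simp
    · exact (hpos n hn).le
  have hex : ∃ n : ℕ, (n : ℝ) + 1 ≠ t := by
    by_contra! hcon
    have e0 := hcon 0
    have e1 := hcon 1
    rw [← e1] at e0; norm_num at e0
  obtain ⟨n, hn⟩ := hex
  have hp := hs.summable.tsum_pos hnn n (hpos n hn)
  rw [hs.tsum_eq] at hp
  change 0 < sS q (y + 1) - c * sS q y - b * (sS q (x + 1) - c * sS q x) at hp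
  rw [he] at hp
  linarith

theorem sS_mono {x y : ℝ} (hx : 0 < x) (hxy : x < y) :
    sS q (x + 1) / sS q x < sS q (y + 1) / sS q y := by
  have p1 := sS_pos h0 h1 hx
  have p2 := sS_pos h0 h1 (show 0 < x + 1 by linarith)
  have p3 := sS_pos h0 h1 (hx.trans hxy)
  have he : sS q (x + 1) = sS q (x + 1) / sS q x * sS q x := by field_simp
  rw [lt_div_iff₀ p3]
  exact sS_key h0 h1 hx hxy (div_pos p2 p1) he.ge le_rfl he

theorem sS_small {c : ℝ} (hc : 0 < c) : ∃ x, 0 < x ∧ sS q (x + 1) < c * sS q x := by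
  obtain ⟨N, hN⟩ := exists_nat_gt (sS q 1 / (c * q))
  have p1 := sS_pos h0 h1 one_pos
  have hN0 : (0 : ℝ) < N := lt_trans (by positivity) hN
  refine ⟨1 / N, by positivity, ?_⟩
  have a1 : sS q (1 / N + 1) ≤ sS q 1 :=
    sS_anti h0 h1 one_pos (by have : (0 : ℝ) < 1 / N := by positivity
                              linarith)
  have a2 : ∑ n ∈ Finset.range N, aT q (1 / N) n ≤ sS q (1 / N) :=
    (aT_summable h0 h1 (by positivity)).sum_le_tsum _ (fun n _ => (aT_pos h0 h1 _ n).le)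
  have a3 : ∑ n ∈ Finset.range N, q ≤ ∑ n ∈ Finset.range N, aT q (1 / N) n := by
    refine Finset.sum_le_sum fun n hn => ?_
    have hn' : (n : ℝ) + 1 ≤ N := by exact_mod_cast Finset.mem_range.1 hn
    have hq : q ≤ q ^ (((n : ℝ) + 1) * (1 / N)) := by
      conv_lhs => rw [← Real.rpow_one q]
      apply Real.rpow_le_rpow_of_exponent_ge h0 h1.le
      rw [mul_one_div, div_le_one hN0]; exact hn'
    have d := den_pos h0 h1 n
    unfold aT
    rw [le_div_iff₀ d]
    have d2 : 1 - q ^ (n + 1) ≤ 1 := by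
      have : 0 < q ^ (n + 1) := by positivity
      linarith
    have d3 : (1 : ℝ) ≤ ((n : ℝ) + 1) ^ 2 := one_le_pow₀ (by
      have : (0 : ℝ) ≤ n := Nat.cast_nonneg n
      linarith)
    calc q * (1 - q ^ (n + 1)) ≤ q * 1 := by gcongr
      _ = 1 * q := by ring
      _ ≤ _ := by gcongr
  simp only [Finset.sum_const, Finset.card_range, nsmul_eq_mul] at a3
  rw [div_lt_iff₀ (by positivity)] at hN
  have : c * (N * q) ≤ c * sS q (1 / N) := by gcongr; linarith
  nlinarith

theorem sS_large {c : ℝ} (hc : 0 < c) (hcq : c < q) :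
    ∃ x, 0 < x ∧ c * sS q x < sS q (x + 1) := by
  set A := aT q 0 0 with hA
  have hA0 : 0 < A := aT_pos h0 h1 0 0
  have p1 := sS_pos h0 h1 one_pos
  have hlim : Filter.Tendsto (fun n : ℕ => c * sS q 1 * q ^ n) Filter.atTop (nhds 0) := by
    simpa using (tendsto_pow_atTop_nhds_zero_of_lt_one h0.le h1).const_mul (c * sS q 1)
  obtain ⟨m, hm⟩ := (hlim.eventually_lt_const
    (show 0 < (q - c) * A by have := sub_pos.2 hcq; positivity)).exists
  refine ⟨(m : ℝ) + 2, by positivity, ?_⟩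
  have hs := aT_summable h0 h1 (show 0 < (m : ℝ) + 2 by positivity)
  have hs1 := aT_summable h0 h1 (show 0 < (m : ℝ) + 2 + 1 by positivity)
  have e0 : aT q ((m : ℝ) + 2) 0 = A * q ^ (m + 2) := by
    have := aT_shift h0 h1 0 ((m : ℝ) + 2) 0
    rw [zero_add] at this
    rw [this, ← Real.rpow_natCast]; push_cast; norm_num [hA]
  have b1 : aT q ((m : ℝ) + 2) 0 * q ≤ sS q ((m : ℝ) + 2 + 1) := by
    have := hs1.le_tsum 0 (fun n _ => (aT_pos h0 h1 _ n).le)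
    rw [aT_succ h0 h1] at this
    simpa [sS] using this
  have b2 : sS q ((m : ℝ) + 2) ≤ aT q ((m : ℝ) + 2) 0 + q ^ (2 * m + 2) * sS q 1 := by
    have t1 := hs.tsum_eq_zero_add
    have s1 := aT_summable h0 h1 one_pos
    have t2 := s1.tsum_eq_zero_add
    have t3 : ∑' n, aT q ((m : ℝ) + 2) (n + 1) ≤ ∑' n, q ^ (2 * m + 2) * aT q 1 (n + 1) := by
      refine ((summable_nat_add_iff 1).2 hs).tsum_le_tsum (fun n => ?_)
        (((summable_nat_add_iff 1).2 s1).mul_left _)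
      have : (m : ℝ) + 2 = 1 + (m + 1) := by ring
      rw [this, aT_shift h0 h1, mul_comm]
      refine mul_le_mul_of_nonneg_right ?_ (aT_pos h0 h1 _ _).le
      rw [← Real.rpow_natCast]
      apply Real.rpow_le_rpow_of_exponent_ge h0 h1.le
      push_cast
      have : (0 : ℝ) ≤ n := Nat.cast_nonneg n
      have : (0 : ℝ) ≤ m := Nat.cast_nonneg m
      nlinarith [mul_nonneg ‹(0 : ℝ) ≤ n› this]
    rw [tsum_mul_left] at t3
    have t4 : ∑' n, aT q 1 (n + 1) ≤ sS q 1 := by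
      unfold sS; rw [t2]; linarith [aT_pos h0 h1 1 0]
    have t5 : q ^ (2 * m + 2) * ∑' n, aT q 1 (n + 1) ≤ q ^ (2 * m + 2) * sS q 1 := by gcongr
    unfold sS at *
    linarith
  rw [e0] at b1 b2
  have hq2 : 0 < q ^ (m + 2) := by positivity
  have := mul_lt_mul_of_pos_right hm hq2
  have e : q ^ (2 * m + 2) = q ^ m * q ^ (m + 2) := by ring
  rw [e] at b2
  have := mul_le_mul_of_nonneg_left b2 hc.le
  nlinarith

theorem sS_exists {c : ℝ} (hc : 0 < c) (hcq : c < q) :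
    ∃ x, 0 < x ∧ c * sS q x = sS q (x + 1) := by
  obtain ⟨a, ha, ha'⟩ := sS_small h0 h1 hc
  obtain ⟨b, hb, hb'⟩ := sS_large h0 h1 hc hcq
  have hcont : ContinuousOn (fun x => sS q (x + 1) - c * sS q x) (Set.Ioi 0) := by
    refine ContinuousOn.sub ?_ (continuousOn_const.mul (sS_cont h0 h1))
    refine (sS_cont h0 h1).comp (by fun_prop) ?_
    intro x hx
    have : (0 : ℝ) < x := hx
    show (0 : ℝ) < x + 1
    linarith
  have := isPreconnected_Ioi.intermediate_value (Set.mem_Ioi.2 ha) (Set.mem_Ioi.2 hb) hcont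
  obtain ⟨x, hx, hx'⟩ := this (show (0 : ℝ) ∈ Set.Icc _ _ from ⟨by linarith, by linarith⟩)
  exact ⟨x, hx, by simp only at hx'; linarith⟩

end

/-- for `q ∈ (0,1)`, `R ∈ (1/2,1)`, `L = 1 − R`, there is a unique `θ₀ > 0`
with `(R/q)·Ψ_q''(θ₀+1) = L·Ψ_q''(θ₀)` (i.e. `κ_{q,q,R}(θ₀) = 0`); moreover, with
`θ_m = log(2q/(1+q))/log q`, any such `θ₀` satisfies `θ₀ < θ_m` if and only if
`R > q·Ψ_q''(θ_m)/(q·Ψ_q''(θ_m) + Ψ_q''(θ_m+1))`. -/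
theorem first_particle_critical_point (q R L : ℝ) (hq : q ∈ Set.Ioo (0 : ℝ) 1)
    (hR : R ∈ Set.Ioo (1 / 2 : ℝ) 1) (hL : L = 1 - R) :
    (∃! θ₀ : ℝ, 0 < θ₀ ∧ (R / q) * PsiD q 2 (θ₀ + 1) = L * PsiD q 2 θ₀) ∧
    (∀ θ₀ : ℝ, 0 < θ₀ → (R / q) * PsiD q 2 (θ₀ + 1) = L * PsiD q 2 θ₀ →
      (θ₀ < Real.log (2 * q / (1 + q)) / Real.log q ↔
        R > q * PsiD q 2 (Real.log (2 * q / (1 + q)) / Real.log q) /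
          (q * PsiD q 2 (Real.log (2 * q / (1 + q)) / Real.log q) +
            PsiD q 2 (Real.log (2 * q / (1 + q)) / Real.log q + 1)))) := by
  obtain ⟨h0, h1⟩ := hq
  obtain ⟨hR1, hR2⟩ := hR
  have hR0 : 0 < R := by linarith
  have hL0 : 0 < L := by linarith
  have hlog : Real.log q < 0 := Real.log_neg h0 h1
  have hP : ∀ x, PsiD q 2 x = Real.log q ^ 3 * sS q x := fun x => rfl
  have hl3 : Real.log q ^ 3 < 0 := Odd.pow_neg (by decide) hlog
  have hiff : ∀ x, 0 < x → ((R / q) * PsiD q 2 (x + 1) = L * PsiD q 2 x ↔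
      sS q (x + 1) / sS q x = q * L / R) := by
    intro x hx
    have p := sS_pos h0 h1 hx
    rw [hP, hP, div_eq_div_iff p.ne' hR0.ne']
    have e1 : R / q * (Real.log q ^ 3 * sS q (x + 1)) = Real.log q ^ 3 / q * (sS q (x + 1) * R) := by
      ring
    have e2 : L * (Real.log q ^ 3 * sS q x) = Real.log q ^ 3 / q * (q * L * sS q x) := by
      field_simp
    rw [e1, e2, mul_right_inj' (div_ne_zero hl3.ne h0.ne')]
  have hmono : StrictMonoOn (fun x => sS q (x + 1) / sS q x) (Set.Ioi 0) :=
    fun x hx y _ hxy => sS_mono h0 h1 hx hxy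
  refine ⟨?_, ?_⟩
  · obtain ⟨x, hx, hx'⟩ := sS_exists h0 h1 (c := q * L / R) (by positivity) (by
      rw [div_lt_iff₀ hR0]; gcongr; linarith)
    have hxe : sS q (x + 1) / sS q x = q * L / R := by
      rw [← hx']; field_simp [(sS_pos h0 h1 hx).ne']
    refine ⟨x, ⟨hx, (hiff x hx).2 hxe⟩, ?_⟩
    rintro y ⟨hy, hy'⟩
    exact hmono.injOn hy hx (((hiff y hy).1 hy').trans hxe.symm)
  · intro x hx he
    have he' := (hiff x hx).1 he
    set m := Real.log (2 * q / (1 + q)) / Real.log q with hm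
    have hm0 : 0 < m := by
      apply div_pos_of_neg_of_neg _ hlog
      apply Real.log_neg (by positivity)
      rw [div_lt_one (by linarith)]; linarith
    have p := sS_pos h0 h1 hm0
    have p1 := sS_pos h0 h1 (show 0 < m + 1 by linarith)
    rw [← hmono.lt_iff_lt hx hm0]
    simp only [he', hP]
    have e : q * (Real.log q ^ 3 * sS q m) / (q * (Real.log q ^ 3 * sS q m) +
        Real.log q ^ 3 * sS q (m + 1)) = q * sS q m / (q * sS q m + sS q (m + 1)) := by
      rw [← mul_div_mul_left (q * sS q m) _ hl3.ne]; congr 1 <;> ring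
    rw [e, gt_iff_lt, div_lt_div_iff₀ hR0 p, div_lt_iff₀ (by positivity), hL]
    constructor <;> intro h <;> nlinarith
end
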